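/- arXiv:1502.01543 — 5 statements merged into one kernel-verified Lean document; each statement's English description precedes it below -/
import Mathlib

section
/- For every permutation w ∈ S_n and every 1 ≤ k ≤ n-1, the subsequence of w formed by all its k-peaks and k-valleys (taken in their order of position in w) is a k-zigzagging subsequence of maximal length; in particular zs_k(w) equals the number of k-peaks of w plus the number of k-valleys of w. -/
open Nat

/-- `ι` enumerates (the positions of) an alternating subsequence of `w`:
positions are strictly increasing and the values satisfy `w_{i₁} > w_{i₂} < w_{i₃} > ⋯`. -/
def IsAltSeq {n : ℕ} (w : Equiv.Perm (Fin n)) {s : ℕ} (ι : Fin s → Fin n) : Prop :=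
  StrictMono ι ∧
    ∀ (j : ℕ) (hj : j + 1 < s),
      if j % 2 = 0 then
        (w (ι ⟨j + 1, hj⟩) : ℕ) < (w (ι ⟨j, Nat.lt_of_succ_lt hj⟩) : ℕ)
      else
        (w (ι ⟨j, Nat.lt_of_succ_lt hj⟩) : ℕ) < (w (ι ⟨j + 1, hj⟩) : ℕ)

/-- `ι` enumerates a reverse alternating subsequence of `w`:
`w_{i₁} < w_{i₂} > w_{i₃} < ⋯`. -/
def IsRevAltSeq {n : ℕ} (w : Equiv.Perm (Fin n)) {s : ℕ} (ι : Fin s → Fin n) : Prop :=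
  StrictMono ι ∧
    ∀ (j : ℕ) (hj : j + 1 < s),
      if j % 2 = 0 then
        (w (ι ⟨j, Nat.lt_of_succ_lt hj⟩) : ℕ) < (w (ι ⟨j + 1, hj⟩) : ℕ)
      else
        (w (ι ⟨j + 1, hj⟩) : ℕ) < (w (ι ⟨j, Nat.lt_of_succ_lt hj⟩) : ℕ)

/-- Each pair of neighbouring entries of the subsequence differs by at least `k`
in absolute value. -/
def HasGaps (k : ℕ) {n : ℕ} (w : Equiv.Perm (Fin n)) {s : ℕ} (ι : Fin s → Fin n) : Prop :=
  ∀ (j : ℕ) (hj : j + 1 < s),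
    (k : ℤ) ≤ |((w (ι ⟨j, Nat.lt_of_succ_lt hj⟩) : ℕ) : ℤ) -
               ((w (ι ⟨j + 1, hj⟩) : ℕ) : ℤ)|

/-- `as_k(w)`: the maximal length of a `k`-alternating subsequence of `w`. -/
noncomputable def kAltLen (n k : ℕ) (w : Equiv.Perm (Fin n)) : ℕ :=
  sSup {s : ℕ | ∃ ι : Fin s → Fin n, IsAltSeq w ι ∧ HasGaps k w ι}

/-- The maximal length of a `k`-reverse-alternating subsequence of `w`. -/
noncomputable def kRevAltLen (n k : ℕ) (w : Equiv.Perm (Fin n)) : ℕ :=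
  sSup {s : ℕ | ∃ ι : Fin s → Fin n, IsRevAltSeq w ι ∧ HasGaps k w ι}

/-- `zs_k(w)`: the maximal length of a `k`-zigzagging subsequence of `w`. -/
noncomputable def kZigLen (n k : ℕ) (w : Equiv.Perm (Fin n)) : ℕ :=
  sSup {s : ℕ | ∃ ι : Fin s → Fin n, (IsAltSeq w ι ∨ IsRevAltSeq w ι) ∧ HasGaps k w ι}

/-- The section `w_s ⋯ w_t` is a `k`-up: `s < t` and `w_t - w_s ≥ k`. -/
def IsKUp (k : ℕ) {n : ℕ} (w : Equiv.Perm (Fin n)) (s t : Fin n) : Prop :=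
  s < t ∧ (w s : ℕ) + k ≤ (w t : ℕ)

/-- The section `w_s ⋯ w_t` is a `k`-down: `s < t` and `w_s - w_t ≥ k`. -/
def IsKDown (k : ℕ) {n : ℕ} (w : Equiv.Perm (Fin n)) (s t : Fin n) : Prop :=
  s < t ∧ (w t : ℕ) + k ≤ (w s : ℕ)

/-- The section `w_i ⋯ w_j` is `k`-ascending: `w_i` is its minimum, `w_j` its maximum,
`w_j - w_i ≥ k`, and there is no `k`-down inside it. -/
def IsKAsc (k : ℕ) {n : ℕ} (w : Equiv.Perm (Fin n)) (i j : Fin n) : Prop :=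
  i < j ∧
  (∀ t : Fin n, i ≤ t → t ≤ j → (w i : ℕ) ≤ (w t : ℕ) ∧ (w t : ℕ) ≤ (w j : ℕ)) ∧
  (w i : ℕ) + k ≤ (w j : ℕ) ∧
  ∀ s t : Fin n, i ≤ s → t ≤ j → ¬ IsKDown k w s t

/-- The section `w_i ⋯ w_j` is `k`-descending: `w_i` is its maximum, `w_j` its minimum,
`w_i - w_j ≥ k`, and there is no `k`-up inside it. -/
def IsKDesc (k : ℕ) {n : ℕ} (w : Equiv.Perm (Fin n)) (i j : Fin n) : Prop :=
  i < j ∧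
  (∀ t : Fin n, i ≤ t → t ≤ j → (w t : ℕ) ≤ (w i : ℕ) ∧ (w j : ℕ) ≤ (w t : ℕ)) ∧
  (w j : ℕ) + k ≤ (w i : ℕ) ∧
  ∀ s t : Fin n, i ≤ s → t ≤ j → ¬ IsKUp k w s t

/-- `w_i ⋯ w_j` is a maximal `k`-ascending section: it is `k`-ascending and it is not
contained in any other `k`-ascending section. -/
def IsMaxKAsc (k : ℕ) {n : ℕ} (w : Equiv.Perm (Fin n)) (i j : Fin n) : Prop :=
  IsKAsc k w i j ∧ ∀ i' j' : Fin n, IsKAsc k w i' j' → i' ≤ i → j ≤ j' → i' = i ∧ j' = j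

/-- `w_i ⋯ w_j` is a maximal `k`-descending section. -/
def IsMaxKDesc (k : ℕ) {n : ℕ} (w : Equiv.Perm (Fin n)) (i j : Fin n) : Prop :=
  IsKDesc k w i j ∧ ∀ i' j' : Fin n, IsKDesc k w i' j' → i' ≤ i → j ≤ j' → i' = i ∧ j' = j

/-- `w_p` is a `k`-peak of `w`: `p` is the right end of a maximal `k`-ascending section
or the left end of a maximal `k`-descending section. -/
def IsKPeakPos (k : ℕ) {n : ℕ} (w : Equiv.Perm (Fin n)) (p : Fin n) : Prop :=
  (∃ i, IsMaxKAsc k w i p) ∨ (∃ j, IsMaxKDesc k w p j)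

/-- `w_p` is a `k`-valley of `w`: `p` is the left end of a maximal `k`-ascending section
or the right end of a maximal `k`-descending section. -/
def IsKValleyPos (k : ℕ) {n : ℕ} (w : Equiv.Perm (Fin n)) (p : Fin n) : Prop :=
  (∃ j, IsMaxKAsc k w p j) ∨ (∃ i, IsMaxKDesc k w i p)

/-- `f` has a local maximum of prominence at least `k` at `p`: some value of `f` lies at least `k`
below `f p`, and so does some value of `f` strictly between `p` and any point where `f` is
larger. -/
def IsProminent {α : Type*} [LinearOrder α] (k : ℤ) (f : α → ℤ) (p : α) : Prop :=
  (∃ i, f i + k ≤ f p) ∧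
    ∀ q, f p < f q → ∃ i, (p < i ∧ i < q ∨ q < i ∧ i < p) ∧ f i + k ≤ f p

/-- The section of `f` from `i` to `j` is `k`-ascending. -/
def IsAscending {α : Type*} [LinearOrder α] (k : ℤ) (f : α → ℤ) (i j : α) : Prop :=
  i < j ∧ (∀ t, i ≤ t → t ≤ j → f i ≤ f t ∧ f t ≤ f j) ∧ f i + k ≤ f j ∧
    ∀ s t, i ≤ s → t ≤ j → s < t → ¬ f t + k ≤ f s

/-- The section of `f` from `i` to `j` is maximal among the `k`-ascending ones. -/
def IsMaxAscending {α : Type*} [LinearOrder α] (k : ℤ) (f : α → ℤ) (i j : α) : Prop :=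
  IsAscending k f i j ∧ ∀ i' j', IsAscending k f i' j' → i' ≤ i → j ≤ j' → i' = i ∧ j' = j

/-- The values of `f` along `g` alternately fall and rise by at least `k`, falling first. -/
def IsZigzag {α : Type*} (k : ℤ) (f : α → ℤ) {s : ℕ} (g : Fin s → α) : Prop :=
  ∀ (j : ℕ) (hj : j + 1 < s),
    if j % 2 = 0 then f (g ⟨j + 1, hj⟩) + k ≤ f (g ⟨j, Nat.lt_of_succ_lt hj⟩)
    else f (g ⟨j, Nat.lt_of_succ_lt hj⟩) + k ≤ f (g ⟨j + 1, hj⟩)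

section Prominent

variable {α : Type*} [LinearOrder α] {k : ℤ} {f : α → ℤ}

theorem isProminent_dual {p : α} :
    IsProminent k (fun x : αᵒᵈ => f (OrderDual.ofDual x)) (OrderDual.toDual p) ↔
      IsProminent k f p := by
  unfold IsProminent
  refine and_congr Iff.rfl (forall_congr' fun q => imp_congr Iff.rfl (exists_congr fun i => ?_))
  refine and_congr ⟨?_, ?_⟩ Iff.rfl <;>
  · rintro (⟨h1, h2⟩ | ⟨h1, h2⟩)
    · exact Or.inr ⟨h2, h1⟩
    · exact Or.inl ⟨h2, h1⟩

/-- To the left of a prominent point `p`, the function `f` stays at most `f p` as long as no point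
at least `k` below `f p` has been passed. -/
theorem IsProminent.le_of_lt_of_le {p : α} (hp : IsProminent k f p) {i : α}
    (hmax : ∀ t < p, f t + k ≤ f p → t ≤ i) {t : α} (hit : i ≤ t) (htp : t ≤ p) :
    f t ≤ f p := by
  by_contra! h
  obtain ⟨j, hj, hle⟩ := hp.2 t h
  have := hmax j (by grind) hle
  grind

theorem isAscending_dual {i j : α} :
    IsAscending k (fun x : αᵒᵈ => f (OrderDual.ofDual x)) (OrderDual.toDual j)
      (OrderDual.toDual i) ↔ IsAscending k (-f) i j := by
  refine and_congr Iff.rfl (and_congr ?_ (and_congr ?_ ?_))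
  · refine forall_congr' fun t => ?_
    simp only [OrderDual.ofDual_toDual, Pi.neg_apply]
    exact ⟨fun h h1 h2 => (h h2 h1).symm.imp neg_le_neg neg_le_neg,
      fun h h1 h2 => (h h2 h1).symm.imp neg_le_neg_iff.1 neg_le_neg_iff.1⟩
  · simp only [OrderDual.ofDual_toDual, Pi.neg_apply]
    omega
  · constructor
    · intro h s t h1 h2 h3 h4
      refine h (OrderDual.toDual t) (OrderDual.toDual s) h2 h1 h3 ?_
      simp only [OrderDual.ofDual_toDual, Pi.neg_apply] at h4 ⊢
      omega
    · intro h s t h1 h2 h3 h4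
      refine h (OrderDual.ofDual t) (OrderDual.ofDual s) h2 h1 h3 ?_
      simp only [Pi.neg_apply] at h4 ⊢
      omega

theorem isMaxAscending_dual {i j : α} :
    IsMaxAscending k (fun x : αᵒᵈ => f (OrderDual.ofDual x)) (OrderDual.toDual j)
      (OrderDual.toDual i) ↔ IsMaxAscending k (-f) i j := by
  refine and_congr isAscending_dual ⟨?_, ?_⟩
  · intro h i' j' h1 h2 h3
    exact (h (OrderDual.toDual j') (OrderDual.toDual i') (isAscending_dual.2 h1) h3 h2).symm
  · intro h j' i' h1 h2 h3
    exact (h (OrderDual.ofDual i') (OrderDual.ofDual j') (isAscending_dual.1 h1) h3 h2).symm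

variable [Finite α]

theorem exists_isProminent_mem (hk : 0 < k) (s : Set α) {c : α} (hc : c ∈ s)
    (hi : ∃ i, f i + k ≤ f c)
    (hs : ∀ u ∉ s, ∀ y ∈ s, ∃ i, (i = u ∨ y < i ∧ i < u ∨ u < i ∧ i < y) ∧ f i + k ≤ f c) :
    ∃ y ∈ s, IsProminent k f y := by
  obtain ⟨y, hy, hmax⟩ := Set.exists_max_image s f s.toFinite ⟨c, hc⟩
  have hcy := hmax c hc
  refine ⟨y, hy, hi.imp fun i hi => hi.trans hcy, fun u hu => ?_⟩
  have hus : u ∉ s := fun h => (hmax u h).not_gt hu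
  obtain ⟨i, rfl | hb, hle⟩ := hs u hus y hy
  · omega
  · exact ⟨i, hb, hle.trans hcy⟩

theorem exists_isProminent_mem_Ioo (hk : 0 < k) {a b c : α} (hac : a < c) (hcb : c < b)
    (ha : f a + k ≤ f c) (hb : f b + k ≤ f c) : ∃ y ∈ Set.Ioo a b, IsProminent k f y := by
  refine exists_isProminent_mem hk (Set.Ioo a b) ⟨hac, hcb⟩ ⟨a, ha⟩ fun u hu y hy => ?_
  obtain ⟨hay, hyb⟩ := hy
  rcases lt_trichotomy u a with h | rfl | h
  · exact ⟨a, Or.inr (Or.inr ⟨h, hay⟩), ha⟩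
  · exact ⟨u, Or.inl rfl, ha⟩
  · rcases lt_trichotomy u b with h' | rfl | h'
    · exact absurd ⟨h, h'⟩ hu
    · exact ⟨u, Or.inl rfl, hb⟩
    · exact ⟨b, Or.inr (Or.inl ⟨hyb, h'⟩), hb⟩

theorem exists_greatest_lt (P : α → Prop) {p : α} (h : ∃ i < p, P i) :
    ∃ i < p, P i ∧ ∀ t < p, P t → t ≤ i := by
  obtain ⟨i, hi, hmax⟩ := Set.exists_max_image {i | i < p ∧ P i} id (Set.toFinite _) h
  exact ⟨i, hi.1, hi.2, fun t ht hP => hmax t ⟨ht, hP⟩⟩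

/-- Two prominent points of `f` are separated by one of `-f`. -/
theorem IsProminent.exists_between (hf : Function.Injective f) (hk : 0 < k) {p q : α}
    (hp : IsProminent k f p) (hq : IsProminent k f q) (hpq : p < q) :
    ∃ y ∈ Set.Ioo p q, IsProminent k (-f) y := by
  suffices h : ∃ c, p < c ∧ c < q ∧ f c + k ≤ f p ∧ f c + k ≤ f q by
    obtain ⟨c, h1, h2, h3, h4⟩ := h
    exact exists_isProminent_mem_Ioo hk h1 h2 (by simp; omega) (by simp; omega)
  rcases lt_or_gt_of_ne (hf.ne hpq.ne) with h | h
  · obtain ⟨i, hi, hle⟩ := hp.2 q h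
    exact ⟨i, by grind, by grind, hle, by omega⟩
  · obtain ⟨i, hi, hle⟩ := hq.2 p h
    exact ⟨i, by grind, by grind, by omega, hle⟩

/-- If `f p` is maximal on the section spanned by `p` and a point `q` prominent for `-f`, and `f q`
is less than `k` below `f p`, then nothing to the left of `p` is at least `k` below `f p`. -/
theorem IsProminent.no_low_of_lt {p q : α}
    (hp : IsProminent k f p) (hq : IsProminent k (-f) q) (hlt : f p < f q + k)
    (hmax : ∀ t, (p ≤ t ∧ t ≤ q ∨ q ≤ t ∧ t ≤ p) → f t ≤ f p) :
    ¬ ∃ i < p, f i + k ≤ f p := by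
  intro h
  obtain ⟨i, hip, hi, hgr⟩ := exists_greatest_lt (fun i => f i + k ≤ f p) h
  obtain ⟨v, hv, hvq⟩ := hq.2 i (by simp; omega)
  simp only [Pi.neg_apply] at hvq
  have hvp : ¬ (i ≤ v ∧ v ≤ p) := fun h => by
    have := hp.le_of_lt_of_le hgr h.1 h.2
    omega
  have := hmax v
  grind

/-- A prominent point of `f` lies at least `k` above a prominent point of `-f` when the two are
the extreme points of the section they span. -/
theorem IsProminent.add_le (hk : 0 < k) {p q : α}
    (hp : IsProminent k f p) (hq : IsProminent k (-f) q)
    (hmax : ∀ t, (p ≤ t ∧ t ≤ q ∨ q ≤ t ∧ t ≤ p) → f t ≤ f p) : f q + k ≤ f p := by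
  by_contra! hlt
  have h1 := hp.no_low_of_lt hq hlt hmax
  have h2 := (isProminent_dual.2 hp).no_low_of_lt (isProminent_dual.2 hq) hlt
    (fun t ht => hmax (OrderDual.ofDual t) (by
      rcases ht with ⟨h1, h2⟩ | ⟨h1, h2⟩
      · exact Or.inr ⟨h2, h1⟩
      · exact Or.inl ⟨h2, h1⟩))
  obtain ⟨i, hi⟩ := hp.1
  rcases lt_trichotomy i p with h | rfl | h
  · exact h1 ⟨i, h, hi⟩
  · omega
  · exact h2 ⟨OrderDual.toDual i, h, hi⟩

/-- No point is prominent for both `f` and `-f`. -/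
theorem IsProminent.not_neg (hk : 0 < k) {p : α} (hp : IsProminent k f p) :
    ¬ IsProminent k (-f) p := fun hq => by
  have := hp.add_le hk hq fun t ht => by
    obtain rfl : t = p := by grind
    exact le_rfl
  omega

/-- Between consecutive prominent points, of `f` and of `-f`, the values drop by at least `k`. -/
theorem IsProminent.add_le_of_consecutive (hk : 0 < k) {p q : α} (hpq : p < q)
    (hp : IsProminent k f p) (hq : IsProminent k (-f) q)
    (hcons : ∀ y ∈ Set.Ioo p q, ¬ IsProminent k (-f) y) : f q + k ≤ f p := by
  refine hp.add_le hk hq fun x hx => ?_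
  by_contra! h
  obtain ⟨i, hi, hle⟩ := hp.2 x h
  obtain ⟨y, hy, hv⟩ := exists_isProminent_mem_Ioo (f := -f) (a := p) (b := x) (c := i) hk
    (by grind) (by grind) (by simp; omega) (by simp; omega)
  exact hcons y ⟨hy.1, lt_of_lt_of_le hy.2 (by grind)⟩ hv

/-- A point is the right end of a maximal `k`-ascending section iff it is prominent and some
value to its left is at least `k` below. -/
theorem exists_isMaxAscending_iff (hf : Function.Injective f) (hk : 0 < k) {p : α} :
    (∃ i, IsMaxAscending k f i p) ↔ IsProminent k f p ∧ ∃ i < p, f i + k ≤ f p := by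
  constructor
  · rintro ⟨i, ⟨hip, hmm, hle, hdown⟩, hmax⟩
    refine ⟨⟨⟨i, hle⟩, fun q hq => ?_⟩, i, hip, hle⟩
    rcases lt_or_ge q p with hqp | hpq
    · refine ⟨i, Or.inr ⟨?_, hip⟩, hle⟩
      by_contra! h
      exact (hmm q h hqp.le).2.not_gt hq
    replace hpq : p < q := lt_of_le_of_ne hpq (by rintro rfl; exact lt_irrefl _ hq)
    by_contra! hno
    obtain ⟨r, ⟨hpr, hr⟩, hrmin⟩ :=
      Set.exists_min_image {r | p < r ∧ f p < f r} id (Set.toFinite _) ⟨q, hpq, hq⟩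
    have hrq : r ≤ q := hrmin q ⟨hpq, hq⟩
    have hbefore : ∀ t, p < t → t < r → f t ≤ f p := fun t h1 h2 => by
      by_contra! h
      exact (hrmin t ⟨h1, h⟩).not_gt h2
    have hlow : ∀ t, p < t → t < r → f p < f t + k := fun t h1 h2 =>
      hno t (Or.inl ⟨h1, h2.trans_le hrq⟩)
    have hle_r : ∀ t, i ≤ t → t ≤ r → f t ≤ f r := fun t h1 h2 => by
      rcases h2.eq_or_lt with rfl | h2
      · exact le_rfl
      · have := hmm t h1
        have := hbefore t
        grind
    have hasc : IsAscending k f i r := by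
      refine ⟨hip.trans hpr, fun t h1 h2 => ⟨?_, hle_r t h1 h2⟩, by omega,
        fun s t h1 h2 h3 h4 => ?_⟩
      · rcases h2.eq_or_lt with rfl | h2
        · omega
        · have := hmm t h1
          have := hlow t
          grind
      · have hs := hle_r s h1 (h3.le.trans h2)
        rcases h2.eq_or_lt with rfl | h2
        · omega
        · have := hdown s t h1
          have := hlow t
          have := hmm s h1
          have := hbefore s
          grind
    exact hpr.ne' (hmax i r hasc le_rfl hpr.le).2
  · rintro ⟨hp, hlow⟩
    obtain ⟨i, hip, hle, hgr⟩ := exists_greatest_lt (fun i => f i + k ≤ f p) hlow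
    have hle_p : ∀ t, i ≤ t → t ≤ p → f t ≤ f p := fun t h1 h2 => hp.le_of_lt_of_le hgr h1 h2
    have hasc : IsAscending k f i p := by
      refine ⟨hip, fun t h1 h2 => ⟨?_, hle_p t h1 h2⟩, hle, fun s t h1 h2 h3 h4 => ?_⟩
      · rcases h1.eq_or_lt with rfl | h1
        · exact le_rfl
        rcases h2.eq_or_lt with rfl | h2
        · omega
        · by_contra! h
          exact (hgr t h2 (by omega)).not_gt h1
      · have hs := hle_p s h1 (h3.le.trans h2)
        rcases h2.eq_or_lt with rfl | h2
        · omega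
        · exact (hgr t h2 (h4.trans hs)).not_gt (h1.trans_lt h3)
    obtain ⟨j, hj, hjmin⟩ :=
      Set.exists_min_image {j | IsAscending k f j p} id (Set.toFinite _) ⟨i, hasc⟩
    refine ⟨j, hj, fun i' j' h hi' hj' => ?_⟩
    rcases hj'.eq_or_lt with rfl | hlt
    · exact ⟨le_antisymm hi' (hjmin i' h), rfl⟩
    · have hle := (h.2.1 p (hi'.trans hj.1.le) hj').2
      obtain ⟨x, hx, hxk⟩ := hp.2 j' (lt_of_le_of_ne hle (hf.ne hlt.ne))
      exact absurd hxk (h.2.2.2 p x (hi'.trans hj.1.le) (by grind) (by grind))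

theorem isProminent_iff_maxAscending (hf : Function.Injective f) (hk : 0 < k) {p : α} :
    ((∃ i, IsMaxAscending k f i p) ∨ ∃ j, IsMaxAscending k (-f) p j) ↔ IsProminent k f p := by
  have hdual : (∃ j, IsMaxAscending k (-f) p j) ↔
      IsProminent k f p ∧ ∃ i, p < i ∧ f i + k ≤ f p := by
    rw [← isProminent_dual]
    exact (exists_congr fun j => isMaxAscending_dual.symm).trans
      (exists_isMaxAscending_iff (α := αᵒᵈ) (p := OrderDual.toDual p)
        (hf.comp OrderDual.ofDual.injective) hk)
  rw [exists_isMaxAscending_iff hf hk, hdual, ← and_or_left, and_iff_left_iff_imp]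
  rintro ⟨⟨i, hi⟩, -⟩
  rcases lt_trichotomy i p with h | rfl | h
  · exact Or.inl ⟨i, h, hi⟩
  · omega
  · exact Or.inr ⟨i, h, hi⟩

/-- If the neighbours of the term `g c` of a subsequence lie at least `k` below it, then the open
section bounded by these neighbours contains a prominent point. -/
theorem exists_isProminent_between_neighbours (hk : 0 < k) {s : ℕ} {g : Fin s → α}
    (hg : StrictMono g) (c : Fin s) (hlow : ∃ i, f i + k ≤ f (g c))
    (hl : ∀ j : Fin s, (j : ℕ) + 1 = c → f (g j) + k ≤ f (g c))
    (hr : ∀ j : Fin s, (j : ℕ) = c + 1 → f (g j) + k ≤ f (g c)) :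
    ∃ y, IsProminent k f y ∧ (∀ j < c, g j < y) ∧ ∀ j, c < j → y < g j := by
  obtain ⟨y, hy, hp⟩ := exists_isProminent_mem hk
    {y | (∀ j < c, g j < y) ∧ ∀ j, c < j → y < g j} (c := g c)
    ⟨fun j hj => hg hj, fun j hj => hg hj⟩ hlow (by
      intro u hu y hy
      simp only [Set.mem_ofPred_eq, not_and_or, not_forall, not_lt] at hu
      rcases hu with ⟨j, hjc, huj⟩ | ⟨j, hjc, huj⟩
      · have hj' : (j : ℕ) < c := hjc
        let i : Fin s := ⟨c - 1, by omega⟩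
        have hic : i < c := by simp [Fin.lt_def, i]; omega
        have hji : j ≤ i := by simp [Fin.le_def, i]; omega
        refine ⟨g i, ?_, hl i (by simp [i]; omega)⟩
        rcases (huj.trans (hg.monotone hji)).eq_or_lt with h | h
        · exact Or.inl h.symm
        · exact Or.inr (Or.inr ⟨h, hy.1 i hic⟩)
      · have hj' : (c : ℕ) < j := hjc
        let i : Fin s := ⟨c + 1, by omega⟩
        have hic : c < i := by simp [Fin.lt_def, i]
        have hji : i ≤ j := by simp [Fin.le_def, i]; omega
        refine ⟨g i, ?_, hr i rfl⟩
        rcases ((hg.monotone hji).trans huj).eq_or_lt with h | h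
        · exact Or.inl h
        · exact Or.inr (Or.inl ⟨hy.2 i hic, h⟩))
  exact ⟨y, hp, hy⟩

theorem IsZigzag.le_ncard (hk : 0 < k)
    (hne : {p | IsProminent k f p ∨ IsProminent k (-f) p}.Nonempty) {s : ℕ} {g : Fin s → α}
    (hg : StrictMono g) (hz : IsZigzag k f g) :
    s ≤ {p | IsProminent k f p ∨ IsProminent k (-f) p}.ncard := by
  rcases Nat.lt_or_ge s 2 with hs | hs
  · have := (Set.ncard_pos (Set.toFinite _)).2 hne
    omega
  have key : ∀ c : Fin s, ∃ y, (if (c : ℕ) % 2 = 0 then IsProminent k f y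
      else IsProminent k (-f) y) ∧ (∀ j < c, g j < y) ∧ ∀ j, c < j → y < g j := by
    intro c
    have hsign : ∀ e : α → ℤ, (∀ j : Fin s, (j : ℕ) + 1 = c → e (g j) + k ≤ e (g c)) →
        (∀ j : Fin s, (j : ℕ) = c + 1 → e (g j) + k ≤ e (g c)) →
        ∃ y, IsProminent k e y ∧ (∀ j < c, g j < y) ∧ ∀ j, c < j → y < g j := by
      intro e hl hr
      refine exists_isProminent_between_neighbours hk hg c ?_ hl hr
      rcases Nat.eq_zero_or_pos (c : ℕ) with h0 | h0
      · exact ⟨_, hr ⟨c + 1, by omega⟩ rfl⟩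
      · exact ⟨_, hl ⟨c - 1, by omega⟩ (by simp; omega)⟩
    split_ifs with h
    · refine hsign f (fun j hj => ?_) (fun j hj => ?_)
      · have := hz j (by omega)
        rw [if_neg (by omega)] at this
        convert this
        exact hj.symm
      · have := hz c (by omega)
        rw [if_pos h] at this
        convert this
    · refine hsign (-f) (fun j hj => ?_) (fun j hj => ?_)
      · have := hz j (by omega)
        rw [if_pos (by omega)] at this
        have hc : c = ⟨j + 1, by omega⟩ := Fin.ext hj.symm
        rw [hc]
        simp only [Pi.neg_apply, Fin.eta] at this ⊢
        omega
      · have := hz c (by omega)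
        rw [if_neg h] at this
        have hc : j = ⟨c + 1, by omega⟩ := Fin.ext hj
        rw [hc]
        simp only [Pi.neg_apply, Fin.eta] at this ⊢
        omega
  choose y hy hl hr using key
  have hlt : ∀ a b : Fin s, a < b → y a ≠ y b := by
    intro a b hab heq
    by_cases hpar : (a : ℕ) % 2 = (b : ℕ) % 2
    · have hab' : (a : ℕ) < b := hab
      let c : Fin s := ⟨a + 1, by omega⟩
      have h1 : y a < g c := hr a c (by simp [Fin.lt_def, c])
      have h2 : g c < y b := hl b c (by simp [Fin.lt_def, c]; omega)
      exact (h1.trans h2).ne heq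
    · have ha := hy a
      have hb := hy b
      rw [← heq] at hb
      split_ifs at ha hb
      all_goals first
        | omega
        | exact ha.not_neg hk hb
        | exact hb.not_neg hk ha
  have hinj : Function.Injective y := by
    intro a b heq
    rcases lt_trichotomy a b with h | h | h
    · exact absurd heq (hlt a b h)
    · exact h
    · exact absurd heq.symm (hlt b a h)
  calc s = (Set.range y).ncard := by
        rw [← Set.image_univ, Set.ncard_image_of_injective _ hinj, Set.ncard_univ,
          Nat.card_eq_fintype_card, Fintype.card_fin]
    _ ≤ _ := Set.ncard_le_ncard (by
        rintro _ ⟨c, rfl⟩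
        have := hy c
        split_ifs at this
        · exact Or.inl this
        · exact Or.inr this) (Set.toFinite _)

/-- The increasing enumeration of the prominent points of `f` and `-f` is a zigzag. -/
theorem isZigzag_of_isProminent_zero (hf : Function.Injective f) (hk : 0 < k) {s : ℕ}
    {g : Fin s → α} (hg : StrictMono g)
    (hrange : Set.range g = {p | IsProminent k f p ∨ IsProminent k (-f) p})
    (h0 : ∀ h : 0 < s, IsProminent k f (g ⟨0, h⟩)) : IsZigzag k f g := by
  have hnf : Function.Injective (-f) := fun a b h => hf (neg_injective h)
  have hmem : ∀ j, IsProminent k f (g j) ∨ IsProminent k (-f) (g j) := fun j => by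
    have : g j ∈ Set.range g := ⟨j, rfl⟩
    rwa [hrange] at this
  have hcons : ∀ (j : ℕ) (hj : j + 1 < s), ∀ y ∈ Set.Ioo (g ⟨j, by omega⟩) (g ⟨j + 1, hj⟩),
      ¬ IsProminent k f y ∧ ¬ IsProminent k (-f) y := by
    intro j hj y hy
    rw [← not_or]
    intro h
    obtain ⟨i, rfl⟩ : y ∈ Set.range g := by rw [hrange]; exact h
    have h1 := Fin.lt_def.1 (hg.lt_iff_lt.1 hy.1)
    have h2 := Fin.lt_def.1 (hg.lt_iff_lt.1 hy.2)
    simp only at h1 h2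
    omega
  have htype : ∀ (j : ℕ) (hj : j < s), if j % 2 = 0 then IsProminent k f (g ⟨j, hj⟩)
      else IsProminent k (-f) (g ⟨j, hj⟩) := by
    intro j
    induction j with
    | zero => intro hj; simpa using h0 hj
    | succ j ih =>
      intro hj
      have hprev := ih (by omega)
      have hlt : g ⟨j, by omega⟩ < g ⟨j + 1, hj⟩ := hg (by simp [Fin.lt_def])
      have hno := hcons j hj
      split_ifs at hprev with hpar
      · rw [if_neg (by omega)]
        refine (hmem _).resolve_left fun h => ?_
        obtain ⟨y, hy, hv⟩ := hprev.exists_between hf hk h hlt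
        exact (hno y hy).2 hv
      · rw [if_pos (by omega)]
        refine (hmem _).resolve_right fun h => ?_
        obtain ⟨y, hy, hv⟩ := hprev.exists_between hnf hk h hlt
        rw [neg_neg] at hv
        exact (hno y hy).1 hv
  intro j hj
  have h1 := htype j (by omega)
  have h2 := htype (j + 1) hj
  have hlt : g ⟨j, by omega⟩ < g ⟨j + 1, hj⟩ := hg (by simp [Fin.lt_def])
  have hno := hcons j hj
  split_ifs with hpar
  · rw [if_pos hpar] at h1
    rw [if_neg (by omega)] at h2
    exact h1.add_le_of_consecutive hk hlt h2 fun y hy => (hno y hy).2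
  · rw [if_neg hpar] at h1
    rw [if_pos (by omega)] at h2
    have := h1.add_le_of_consecutive hk hlt (by rwa [neg_neg]) fun y hy => by
      rw [neg_neg]; exact (hno y hy).1
    simp only [Pi.neg_apply] at this
    omega

end Prominent

section Perm

variable {n k : ℕ} (w : Equiv.Perm (Fin n))

/-- The one-line notation of `w` as an integer-valued function. -/
def permVal (p : Fin n) : ℤ := (w p : ℕ)

theorem permVal_injective : Function.Injective (permVal w) := fun a b h => by
  apply w.injective
  apply Fin.ext
  simpa [permVal] using h

theorem isKAsc_iff {i j : Fin n} : IsKAsc k w i j ↔ IsAscending k (permVal w) i j := by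
  simp only [IsKAsc, IsAscending, IsKDown, permVal, not_and]
  norm_cast

theorem isKDesc_iff {i j : Fin n} : IsKDesc k w i j ↔ IsAscending k (-permVal w) i j := by
  simp only [IsKDesc, IsAscending, IsKUp, permVal, not_and, Pi.neg_apply, neg_le_neg_iff]
  refine and_congr Iff.rfl (and_congr (by norm_cast) (and_congr (by omega) ?_))
  refine forall_congr' fun s => forall_congr' fun t => ?_
  refine imp_congr Iff.rfl (imp_congr Iff.rfl (imp_congr Iff.rfl ?_))
  omega

theorem isMaxKAsc_iff {i j : Fin n} : IsMaxKAsc k w i j ↔ IsMaxAscending k (permVal w) i j := by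
  simp only [IsMaxKAsc, IsMaxAscending, isKAsc_iff]

theorem isMaxKDesc_iff {i j : Fin n} :
    IsMaxKDesc k w i j ↔ IsMaxAscending k (-permVal w) i j := by
  simp only [IsMaxKDesc, IsMaxAscending, isKDesc_iff]

theorem isKPeakPos_iff (hk : 0 < k) {p : Fin n} :
    IsKPeakPos k w p ↔ IsProminent k (permVal w) p := by
  simp only [IsKPeakPos, isMaxKAsc_iff, isMaxKDesc_iff]
  exact isProminent_iff_maxAscending (permVal_injective w) (by omega)

theorem isKValleyPos_iff (hk : 0 < k) {p : Fin n} :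
    IsKValleyPos k w p ↔ IsProminent k (-permVal w) p := by
  simp only [IsKValleyPos, isMaxKAsc_iff, isMaxKDesc_iff]
  rw [← isProminent_iff_maxAscending (f := -permVal w)
    (neg_injective.comp (permVal_injective w)) (by omega), neg_neg, or_comm]

theorem isAltSeq_hasGaps_iff (hk : 0 < k) {s : ℕ} {ι : Fin s → Fin n} :
    IsAltSeq w ι ∧ HasGaps k w ι ↔ StrictMono ι ∧ IsZigzag k (permVal w) ι := by
  rw [IsAltSeq, and_assoc, HasGaps, ← forall_and]
  simp only [← forall_and, IsZigzag, permVal]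
  refine and_congr Iff.rfl (forall_congr' fun j => forall_congr' fun hj => ?_)
  grind

theorem isRevAltSeq_hasGaps_iff (hk : 0 < k) {s : ℕ} {ι : Fin s → Fin n} :
    IsRevAltSeq w ι ∧ HasGaps k w ι ↔ StrictMono ι ∧ IsZigzag k (-permVal w) ι := by
  rw [IsRevAltSeq, and_assoc, HasGaps, ← forall_and]
  simp only [← forall_and, IsZigzag, permVal, Pi.neg_apply]
  refine and_congr Iff.rfl (forall_congr' fun j => forall_congr' fun hj => ?_)
  grind

theorem exists_isProminent_permVal (hk : 0 < k) (hkn : k + 1 ≤ n) :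
    ∃ p, IsProminent k (permVal w) p := by
  obtain ⟨p, -, hp⟩ := exists_isProminent_mem (f := permVal w) (k := k) (by omega) Set.univ
    (Set.mem_univ (w.symm ⟨n - 1, by omega⟩))
    ⟨w.symm ⟨0, by omega⟩, by simp [permVal]; omega⟩ (fun u hu => absurd (Set.mem_univ u) hu)
  exact ⟨p, hp⟩

end Perm

/-- The subsequence of `w` formed by all its `k`-peaks and `k`-valleys (in order of
position) is a `k`-zigzagging subsequence of maximal length; in particular `zs_k(w)`
is the number of `k`-peaks plus the number of `k`-valleys of `w`. -/
theorem peaks_valleys_subseq_is_longest_zigzag (n k : ℕ) (hk : 2 ≤ k + 1) (hkn : k + 1 ≤ n)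
    (w : Equiv.Perm (Fin n)) :
    (∃ (m : ℕ) (ι : Fin m → Fin n),
      StrictMono ι ∧
      Set.range ι = {p : Fin n | IsKPeakPos k w p ∨ IsKValleyPos k w p} ∧
      (IsAltSeq w ι ∨ IsRevAltSeq w ι) ∧ HasGaps k w ι ∧
      m = kZigLen n k w) ∧
    kZigLen n k w =
      Nat.card {p : Fin n // IsKPeakPos k w p} +
        Nat.card {p : Fin n // IsKValleyPos k w p} := by
  have hk0 : 0 < k := by omega
  have hkz : (0 : ℤ) < k := by omega
  have hf := permVal_injective w
  simp only [isKPeakPos_iff w hk0, isKValleyPos_iff w hk0]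
  set f := permVal w
  obtain ⟨p, hp⟩ := exists_isProminent_permVal w hk0 hkn
  set S : Set (Fin n) := {p | IsProminent k f p ∨ IsProminent k (-f) p} with hS
  have hSneg : {p | IsProminent k (-f) p ∨ IsProminent k (- -f) p} = S := by
    rw [neg_neg, hS]
    ext
    exact or_comm
  have hne : S.Nonempty := ⟨p, Or.inl hp⟩
  have hcard : S.toFinite.toFinset.card = S.ncard := (Set.ncard_eq_toFinset_card S).symm
  let ι : Fin S.ncard → Fin n := S.toFinite.toFinset.orderEmbOfFin hcard
  have hmono : StrictMono ι := (S.toFinite.toFinset.orderEmbOfFin hcard).strictMono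
  have hrange : Set.range ι = S := by simp [ι]
  have hpos : 0 < S.ncard := (Set.ncard_pos (Set.toFinite _)).2 hne
  have hzig : (IsAltSeq w ι ∨ IsRevAltSeq w ι) ∧ HasGaps k w ι := by
    have h0 : ι ⟨0, hpos⟩ ∈ S := hrange.subset (Set.mem_range_self _)
    rw [or_and_right, isAltSeq_hasGaps_iff w hk0, isRevAltSeq_hasGaps_iff w hk0]
    rcases h0 with h0 | h0
    · exact Or.inl ⟨hmono, isZigzag_of_isProminent_zero hf hkz hmono hrange fun _ => h0⟩
    · exact Or.inr ⟨hmono, isZigzag_of_isProminent_zero (neg_injective.comp hf) hkz hmono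
        (hrange.trans hSneg.symm) fun _ => h0⟩
  have hlen : kZigLen n k w = S.ncard := by
    refine IsGreatest.csSup_eq ⟨⟨ι, hzig⟩, ?_⟩
    rintro s ⟨g, hg⟩
    rw [or_and_right, isAltSeq_hasGaps_iff w hk0, isRevAltSeq_hasGaps_iff w hk0] at hg
    rcases hg with ⟨hg, hz⟩ | ⟨hg, hz⟩
    · exact hz.le_ncard hkz hne hg
    · exact (hz.le_ncard hkz (hSneg ▸ hne) hg).trans_eq (congrArg Set.ncard hSneg)
  refine ⟨⟨S.ncard, ι, hmono, hrange, hzig.1, hzig.2, hlen.symm⟩, ?_⟩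
  rw [hlen]
  exact Set.ncard_union_eq (s := {p | IsProminent k f p}) (t := {p | IsProminent k (-f) p})
    (Set.disjoint_left.2 fun p h1 h2 => h1.not_neg hkz h2) (Set.toFinite _) (Set.toFinite _)
end

section
/- For all integers n and k with n ≥ k+1 ≥ 2, Σ_{w ∈ S_n} zs_k(w) = 2 · Σ_{w ∈ S_n} #{k-peaks of w}; that is, the average k-zigzagging length of permutations in S_n is twice the average number of k-peaks. -/
open Nat

namespace Zigzag

variable {n : ℕ}

/-- Integer-valued version of a `k`-ascending section; descending sections of `g` are the
ascending sections of `-g`. -/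
def Asc (k : ℤ) (g : Fin n → ℤ) (i j : Fin n) : Prop :=
  i < j ∧ (∀ t, i ≤ t → t ≤ j → g i ≤ g t ∧ g t ≤ g j) ∧ g i + k ≤ g j ∧
    ∀ s t, i ≤ s → s < t → t ≤ j → g s < g t + k

/-- A maximal ascending section. -/
def MaxAsc (k : ℤ) (g : Fin n → ℤ) (i j : Fin n) : Prop :=
  Asc k g i j ∧ ∀ i' j', Asc k g i' j' → i' ≤ i → j ≤ j' → i' = i ∧ j' = j

/-- A `k`-peak of `g`; the `k`-valleys of `g` are the `k`-peaks of `-g`. -/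
def Peak (k : ℤ) (g : Fin n → ℤ) (p : Fin n) : Prop :=
  (∃ i, MaxAsc k g i p) ∨ ∃ j, MaxAsc k (-g) p j

/-- Going left from `p`, a value at most `g p - k` is met before a value above `g p`. -/
def RisesTo (k : ℤ) (g : Fin n → ℤ) (p : Fin n) : Prop :=
  ∃ i < p, g i + k ≤ g p ∧ ∀ t, i ≤ t → t ≤ p → g t ≤ g p

/-- Going right from `p`, a value at most `g p - k` is met before a value above `g p`. -/
def FallsFrom (k : ℤ) (g : Fin n → ℤ) (p : Fin n) : Prop :=
  ∃ j, p < j ∧ g j + k ≤ g p ∧ ∀ t, p ≤ t → t ≤ j → g t ≤ g p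

/-- A local description of `k`-peaks, see `peak_iff_localPeak`. -/
def LocalPeak (k : ℤ) (g : Fin n → ℤ) (p : Fin n) : Prop :=
  (RisesTo k g p ∨ FallsFrom k g p) ∧ (RisesTo k g p ∨ ∀ t < p, g t ≤ g p) ∧
    (FallsFrom k g p ∨ ∀ t, p < t → g t ≤ g p)

variable {k : ℤ} {g : Fin n → ℤ}

lemma Asc.exists_maxAsc {i j : Fin n} (h : Asc k g i j) :
    ∃ A B, MaxAsc k g A B ∧ A ≤ i ∧ j ≤ B := by
  classical
  obtain ⟨⟨A, B⟩, hm, hmax⟩ := Finset.exists_max_image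
    (Finset.univ.filter fun q : Fin n × Fin n => Asc k g q.1 q.2 ∧ q.1 ≤ i ∧ j ≤ q.2)
    (fun q => (q.2 : ℤ) - q.1) ⟨(i, j), by simp [h]⟩
  simp only [Finset.mem_filter, Finset.mem_univ, true_and, Prod.forall] at hm hmax
  refine ⟨A, B, ⟨hm.1, fun i' j' h' hi hj => ?_⟩, hm.2⟩
  have := hmax i' j' ⟨h', hi.trans hm.2.1, hm.2.2.trans hj⟩
  simp only [Fin.ext_iff, Fin.le_def] at *
  omega

/-- Every `k`-up contains an ascending section. -/
lemma exists_asc_of_up (hk : 0 < k) {s t : Fin n} (hst : s < t) (h : g s + k ≤ g t) :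
    ∃ a b, Asc k g a b ∧ s ≤ a ∧ b ≤ t := by
  classical
  obtain ⟨⟨a, b⟩, hm, hmin⟩ := Finset.exists_min_image
    (Finset.univ.filter fun q : Fin n × Fin n =>
      s ≤ q.1 ∧ q.1 < q.2 ∧ q.2 ≤ t ∧ g q.1 + k ≤ g q.2)
    (fun q => (q.2 : ℤ) - q.1) ⟨(s, t), by simp [h, hst]⟩
  simp only [Finset.mem_filter, Finset.mem_univ, true_and, Prod.forall] at hm hmin
  obtain ⟨h1, h2, h3, h4⟩ := hm
  have key : ∀ x y, a ≤ x → x < y → y ≤ b → g x + k ≤ g y → x = a ∧ y = b := by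
    intro x y hx hxy hy hg
    have := hmin x y ⟨h1.trans hx, hxy, hy.trans h3, hg⟩
    simp only [Fin.ext_iff, Fin.le_def] at *
    omega
  have bd : ∀ t, a ≤ t → t ≤ b → g a ≤ g t ∧ g t ≤ g b := by
    intro x hx hy
    constructor
    · by_contra hc
      rcases hy.lt_or_eq with hy' | rfl
      · have := key x b hx hy' le_rfl (by omega)
        grind
      · grind
    · by_contra hc
      rcases hx.lt_or_eq with hx' | rfl
      · have := key a x le_rfl hx' hy (by omega)
        grind
      · grind
  refine ⟨a, b, ⟨h2, bd, h4, fun x y hx hxy hy => ?_⟩, h1, h3⟩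
  by_contra hc
  have hy1 := (bd y (by grind) hy).1
  rcases hx.lt_or_eq with hx' | rfl
  · have := key a x le_rfl hx' (by grind) (by omega)
    grind
  · omega

lemma Asc.le_of_neg (hg : Function.Injective g) {A B A' B' a b a' b' : Fin n}
    (h : Asc k g A B) (h' : Asc k (-g) A' B') (hab : Asc k g a b) (hab' : Asc k (-g) a' b')
    (hA : A ≤ a) (hB' : b' ≤ B') (hba : b ≤ a') : B ≤ A' := by
  obtain ⟨h1, h2, h3, h4⟩ := h
  obtain ⟨h1', h2', h3', h4'⟩ := h'
  obtain ⟨i1, -, i3, -⟩ := hab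
  obtain ⟨i1', -, i3', -⟩ := hab'
  simp only [Pi.neg_apply] at *
  have e1 : a < A' := by
    by_contra hc
    have := h4' a b (not_lt.1 hc) i1 (by grind)
    omega
  have e2 : B < b' := by
    by_contra hc
    have := h4 a' b' (by grind) i1' (not_lt.1 hc)
    omega
  by_contra hc
  have f1 := h2 A' (by grind) (by grind)
  have f2 := h2' B (by grind) (by grind)
  have := @hg A' B (by omega)
  grind

lemma LocalPeak.of_maxAsc (hk : 0 < k) {i p : Fin n} (h : MaxAsc k g i p) : LocalPeak k g p := by
  obtain ⟨⟨h1, h2, h3, h4⟩, h5⟩ := h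
  have hL : RisesTo k g p := ⟨i, h1, h3, fun t ht ht' => (h2 t ht ht').2⟩
  refine ⟨.inl hL, .inl hL, ?_⟩
  by_contra! hc
  obtain ⟨hR, t, hpt, ht⟩ := hc
  obtain ⟨j, hj, hmin⟩ := Finset.exists_min_image
    (Finset.univ.filter fun t : Fin n => p < t ∧ g p < g t) id ⟨t, by simp [*]⟩
  simp only [Finset.mem_filter, Finset.mem_univ, true_and, id_eq] at hj hmin
  have hle : ∀ t, p < t → t < j → g t ≤ g p := by
    intro t ht htj
    by_contra hc
    exact absurd (hmin t ⟨ht, not_le.1 hc⟩) (not_le.2 htj)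
  have hlow : ∀ t, p < t → t ≤ j → g p < g t + k := by
    intro t ht htj
    by_contra hc
    refine hR ⟨t, ht, not_lt.1 hc, fun s hs hst => ?_⟩
    rcases hs.lt_or_eq with h | rfl
    · exact hle s h (by grind)
    · exact le_rfl
  have hasc : Asc k g i j := by
    refine ⟨by grind, fun t ht htj => ?_, by omega, fun s t hs hst ht => ?_⟩
    · rcases le_or_gt t p with htp | htp
      · have := h2 t ht htp
        omega
      · have := hlow t htp htj
        rcases htj.lt_or_eq with h | rfl
        · have := hle t htp h
          omega
        · omega
    · rcases le_or_gt t p with htp | htp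
      · exact h4 s t hs hst htp
      · have := hlow t htp ht
        rcases le_or_gt s p with hsp | hsp
        · have := h2 s hs hsp
          omega
        · have := hle s hsp (by grind)
          omega
  have := h5 i j hasc le_rfl hj.1.le
  grind

lemma RisesTo.exists_maxAsc (hk : 0 < k) (hg : Function.Injective g) {p : Fin n} (hL : RisesTo k g p)
    (hR : FallsFrom k g p ∨ ∀ t, p < t → g t ≤ g p) : ∃ i, MaxAsc k g i p := by
  obtain ⟨i₀, hi₀, hik, hmax⟩ := hL
  obtain ⟨i, hi, himax⟩ := Finset.exists_max_image
    (Finset.univ.filter fun t : Fin n => i₀ ≤ t ∧ t < p ∧ g t + k ≤ g p) id ⟨i₀, by simp [*]⟩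
  simp only [Finset.mem_filter, Finset.mem_univ, true_and, id_eq] at hi himax
  have hlow : ∀ t, i < t → t < p → g p < g t + k := by
    intro t ht htp
    by_contra hc
    exact absurd (himax t ⟨by grind, htp, not_lt.1 hc⟩) (not_le.2 ht)
  have hasc : Asc k g i p := by
    refine ⟨hi.2.1, fun t ht htp => ⟨?_, hmax t (by grind) htp⟩, hi.2.2, fun s t hs hst ht => ?_⟩
    · grind
    · have := hmax s (by grind) (by grind)
      have := hmax p (by grind) (by grind)
      grind
  obtain ⟨A, B, hAB, hA, hB⟩ := hasc.exists_maxAsc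
  have hpB : g p ≤ g B := (hAB.1.2.1 p (by grind) hB).2
  have : B = p := by
    rcases hB.lt_or_eq with hlt | h
    · rcases hR with ⟨j, hj, hjk, hjmax⟩ | hR
      · rcases le_or_gt B j with hBj | hBj
        · exact hg (le_antisymm (hjmax B hB hBj) hpB)
        · have := hAB.1.2.2.2 p j (by grind) hj hBj.le
          omega
      · exact hg (le_antisymm (hR B hlt) hpB)
    · exact h.symm
  exact ⟨A, this ▸ hAB⟩

lemma asc_neg_iff_rev {i j : Fin n} :
    Asc k (-g) i j ↔ Asc k (g ∘ Fin.rev) j.rev i.rev := by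
  simp only [Asc, Pi.neg_apply, Function.comp_apply, Fin.rev_rev, Fin.rev_lt_rev]
  constructor <;> rintro ⟨h1, h2, h3, h4⟩ <;>
    refine ⟨h1, fun t ht ht' => ?_, by omega, fun s t hs hst ht => ?_⟩
  · have := h2 t.rev (by simpa using Fin.rev_le_rev.2 ht') (by simpa using Fin.rev_le_rev.2 ht)
    omega
  · have := h4 t.rev s.rev (by simpa using Fin.rev_le_rev.2 ht) (by simpa using hst)
      (by simpa using Fin.rev_le_rev.2 hs)
    omega
  · have := h2 t.rev (by simpa using ht') (by simpa using ht)
    simp only [Fin.rev_rev] at this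
    omega
  · have := h4 t.rev s.rev (by simpa using ht) (by simpa using hst) (by simpa using hs)
    simp only [Fin.rev_rev] at this
    omega

lemma maxAsc_neg_iff_rev {i j : Fin n} :
    MaxAsc k (-g) i j ↔ MaxAsc k (g ∘ Fin.rev) j.rev i.rev := by
  simp only [MaxAsc, asc_neg_iff_rev, and_congr_right_iff]
  refine fun _ => ⟨fun h i' j' h' hi hj => ?_, fun h i' j' h' hi hj => ?_⟩
  · have := h j'.rev i'.rev (by simpa using h') (by simpa using Fin.rev_le_rev.2 hj)
      (by simpa using Fin.rev_le_rev.2 hi)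
    simp [← this.1, ← this.2]
  · have := h j'.rev i'.rev h' (by simpa using hj) (by simpa using hi)
    simpa [and_comm] using this

lemma fallsFrom_iff_rev {p : Fin n} : FallsFrom k g p ↔ RisesTo k (g ∘ Fin.rev) p.rev := by
  simp only [FallsFrom, RisesTo, Function.comp_apply, Fin.rev_rev]
  constructor <;> rintro ⟨j, hj, hk, hmax⟩
  · exact ⟨j.rev, by simpa using hj, by simpa using hk, fun t ht ht' =>
      hmax t.rev (by simpa using Fin.rev_le_rev.2 ht') (by simpa using Fin.rev_le_rev.2 ht)⟩
  · exact ⟨j.rev, by simpa using Fin.rev_lt_rev.2 hj, by simpa using hk, fun t ht ht' => by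
      simpa using hmax t.rev (by simpa using Fin.rev_le_rev.2 ht') (by simpa using ht)⟩

lemma risesTo_iff_rev {p : Fin n} : RisesTo k g p ↔ FallsFrom k (g ∘ Fin.rev) p.rev := by
  have : (g ∘ Fin.rev) ∘ Fin.rev = g := by ext; simp
  rw [fallsFrom_iff_rev, this, Fin.rev_rev]

lemma localPeak_iff_rev {p : Fin n} : LocalPeak k g p ↔ LocalPeak k (g ∘ Fin.rev) p.rev := by
  have h1 : (∀ t < p, g t ≤ g p) ↔ ∀ t, p.rev < t → g t.rev ≤ g p :=
    Fin.rev_surjective.forall.trans <| by simp [Fin.rev_lt_iff]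
  have h2 : (∀ t, p < t → g t ≤ g p) ↔ ∀ t < p.rev, g t.rev ≤ g p :=
    Fin.rev_surjective.forall.trans <| by simp [Fin.lt_rev_iff]
  simp only [LocalPeak, h1, h2, fallsFrom_iff_rev (g := g), risesTo_iff_rev (g := g),
    Function.comp_apply, Fin.rev_rev]
  tauto

lemma peak_iff_localPeak (hk : 0 < k) (hg : Function.Injective g) {p : Fin n} :
    Peak k g p ↔ LocalPeak k g p := by
  constructor
  · rintro (⟨i, h⟩ | ⟨j, h⟩)
    · exact .of_maxAsc hk h
    · exact localPeak_iff_rev.2 (.of_maxAsc hk (maxAsc_neg_iff_rev.1 h))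
  · rintro ⟨hL | hR, h1, h2⟩
    · exact .inl (hL.exists_maxAsc hk hg h2)
    · refine .inr ?_
      obtain ⟨i, hi⟩ := RisesTo.exists_maxAsc hk (hg.comp Fin.rev_injective)
        (fallsFrom_iff_rev.1 hR) (by
          refine h1.imp risesTo_iff_rev.1 fun h t ht => ?_
          simpa using h t.rev (by simpa using Fin.rev_lt_rev.2 ht))
      exact ⟨i.rev, maxAsc_neg_iff_rev.2 (by simpa using hi)⟩

lemma RisesTo.not_localPeak_neg (hk : 0 < k) {p : Fin n} (h : RisesTo k g p) :
    ¬ LocalPeak k (-g) p := by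
  obtain ⟨i, hi, hik, hmax⟩ := h
  rintro ⟨-, ⟨j, hj, hjk, hmin⟩ | h2, -⟩
  · simp only [Pi.neg_apply] at hjk hmin
    rcases le_total i j with hij | hij
    · have := hmax j hij hj.le
      omega
    · have := hmin i hij hi.le
      omega
  · have := h2 i hi
    simp only [Pi.neg_apply] at this
    omega

lemma LocalPeak.not_neg (hk : 0 < k) {p : Fin n} (h : LocalPeak k g p) :
    ¬ LocalPeak k (-g) p := by
  rcases h.1 with h | h
  · exact h.not_localPeak_neg hk
  · rw [localPeak_iff_rev]
    exact (fallsFrom_iff_rev.1 h).not_localPeak_neg hk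

/-- Between two peaks there is a valley. -/
lemma LocalPeak.exists_neg_between (hk : 0 < k) (hg : Function.Injective g) {e e' : Fin n}
    (hlt : e < e') (h : LocalPeak k g e) (h' : LocalPeak k g e') :
    ∃ m, e < m ∧ m < e' ∧ LocalPeak k (-g) m := by
  have key : ∃ j, e < j ∧ j < e' ∧ g j + k ≤ g e ∧ g j + k ≤ g e' := by
    rcases lt_or_gt_of_ne (hg.ne hlt.ne) with hle | hle
    · rcases h.2.2 with ⟨j, hj, hjk, hmax⟩ | h2
      · refine ⟨j, hj, ?_, hjk, by omega⟩
        by_contra hc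
        have := hmax e' hlt.le (not_lt.1 hc)
        omega
      · have := h2 e' hlt
        omega
    · rcases h'.2.1 with ⟨j, hj, hjk, hmax⟩ | h2
      · refine ⟨j, ?_, hj, by omega, hjk⟩
        by_contra hc
        have := hmax e (not_lt.1 hc) hlt.le
        omega
      · have := h2 e hlt
        omega
  obtain ⟨j, h1, h2, h3, h4⟩ := key
  obtain ⟨m, hm, hmin⟩ := Finset.exists_min_image (Finset.Icc e e') g ⟨j, by simp; grind⟩
  simp only [Finset.mem_Icc] at hm hmin
  have hj := hmin j ⟨h1.le, h2.le⟩
  have hem : e < m := by grind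
  have hme : m < e' := by grind
  have hL : RisesTo k (-g) m := ⟨e, hem, by simp; omega, fun t ht ht' => by
    simpa using hmin t ⟨ht, by grind⟩⟩
  have hR : FallsFrom k (-g) m := ⟨e', hme, by simp; omega, fun t ht ht' => by
    simpa using hmin t ⟨by grind, ht'⟩⟩
  exact ⟨m, hem, hme, .inl hL, .inl hL, .inl hR⟩

lemma LocalPeak.exists_between (hk : 0 < k) {e e' m₀ : Fin n}
    (h : LocalPeak k g e) (h' : LocalPeak k (-g) e') (hm₀ : e ≤ m₀) (hm₀' : m₀ ≤ e')
    (hgt : g e < g m₀) : ∃ m, e < m ∧ m < e' ∧ LocalPeak k g m := by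
  obtain ⟨m, hm, hmax⟩ := Finset.exists_max_image (Finset.Icc e e') g ⟨m₀, by simp [*]⟩
  simp only [Finset.mem_Icc] at hm hmax
  have hgm := hmax m₀ ⟨hm₀, hm₀'⟩
  have hem : e < m := by grind
  obtain ⟨j, hej, hjk, hjmax⟩ : FallsFrom k g e := by
    rcases h.2.2 with h2 | h2
    · exact h2
    · have := h2 m hem
      omega
  have hjm : j < m := by
    by_contra hc
    have := hjmax m hem.le (not_lt.1 hc)
    omega
  have hdrop : g e' + k ≤ g m := by
    rcases le_or_gt (g e') (g j) with hle | hlt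
    · omega
    rcases h'.2.1 with ⟨i, hi, hik, hmin⟩ | h2
    · simp only [Pi.neg_apply] at hik hmin
      have hji : j < i := by
        by_contra hc
        have := hmin j (not_lt.1 hc) (by grind)
        omega
      have := hmax i ⟨by grind, hi.le⟩
      omega
    · have := h2 j (by grind)
      simp only [Pi.neg_apply] at this
      omega
  have hme : m < e' := by grind
  have hL : RisesTo k g m := ⟨j, hjm, by omega, fun t ht ht' => hmax t ⟨by grind, by grind⟩⟩
  have hR : FallsFrom k g m := ⟨e', hme, hdrop, fun t ht ht' => hmax t ⟨by grind, by grind⟩⟩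
  exact ⟨m, hem, hme, .inl hL, .inl hL, .inl hR⟩

lemma LocalPeak.gap_of_max_of_min {e e' : Fin n} (hlt : e < e')
    (h : LocalPeak k g e) (h' : LocalPeak k (-g) e')
    (hmax : ∀ t, e ≤ t → t ≤ e' → g t ≤ g e) (hmin : ∀ t, e ≤ t → t ≤ e' → g e' ≤ g t) :
    g e' + k ≤ g e := by
  rcases h.2.2 with ⟨j, hj, hjk, hjmax⟩ | h2
  · rcases le_or_gt j e' with hje | hje
    · have := hmin j hj.le hje
      omega
    · by_contra hc
      rcases h'.2.2 with ⟨i, hi, hik, himin⟩ | h3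
      · simp only [Pi.neg_apply] at hik himin
        rcases le_or_gt i j with hij | hij
        · have := hjmax i (by grind) hij
          omega
        · have := himin j hje.le hij.le
          omega
      · have := h3 j hje
        simp only [Pi.neg_apply] at this
        omega
  · rcases h'.1 with ⟨i, hi, hik, himin⟩ | ⟨i, hi, hik, himin⟩
    · simp only [Pi.neg_apply] at hik himin
      rcases le_or_gt e i with hei | hei
      · have := hmax i hei hi.le
        omega
      · rcases h.2.1 with ⟨j, hj, hjk, hjmax⟩ | h3
        · rcases le_or_gt i j with hij | hij
          · have := himin j hij (by grind)
            omega
          · have := hjmax i hij.le hei.le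
            omega
        · have := h3 i hei
          omega
    · simp only [Pi.neg_apply] at hik
      have := h2 i (by grind)
      omega

/-- A peak followed by a valley with no extremum in between differ by at least `k`. -/
lemma LocalPeak.gap (hk : 0 < k) {e e' : Fin n} (hlt : e < e')
    (h : LocalPeak k g e) (h' : LocalPeak k (-g) e')
    (hno : ∀ m, e < m → m < e' → ¬ LocalPeak k g m ∧ ¬ LocalPeak k (-g) m) :
    g e' + k ≤ g e := by
  refine h.gap_of_max_of_min hlt h' (fun t ht ht' => ?_) (fun t ht ht' => ?_)
  · by_contra hc
    obtain ⟨m, h1, h2, h3⟩ := h.exists_between hk h' ht ht' (not_le.1 hc)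
    exact (hno m h1 h2).1 h3
  · by_contra hc
    obtain ⟨m, h1, h2, h3⟩ := LocalPeak.exists_between hk (localPeak_iff_rev.1 h')
      (e' := e.rev) (m₀ := t.rev)
      (by
        have := localPeak_iff_rev.1 h
        rwa [← neg_neg (g ∘ Fin.rev)] at this)
      (Fin.rev_le_rev.2 ht') (Fin.rev_le_rev.2 ht) (by simpa using hc)
    refine (hno m.rev (by simpa using Fin.rev_lt_rev.2 h2) (by simpa using Fin.rev_lt_rev.2 h1)).2
      (localPeak_iff_rev.2 ?_)
    rwa [Fin.rev_rev]

/-- Consecutive extrema alternate and differ by at least `k`. -/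
lemma LocalPeak.consecutive (hk : 0 < k) (hg : Function.Injective g) {e e' : Fin n} (hlt : e < e')
    (h : LocalPeak k g e) (h' : LocalPeak k g e' ∨ LocalPeak k (-g) e')
    (hno : ∀ m, e < m → m < e' → ¬ LocalPeak k g m ∧ ¬ LocalPeak k (-g) m) :
    LocalPeak k (-g) e' ∧ g e' + k ≤ g e := by
  rcases h' with h' | h'
  · obtain ⟨m, h1, h2, h3⟩ := h.exists_neg_between hk hg hlt h'
    exact absurd h3 (hno m h1 h2).2
  · exact ⟨h', h.gap hk hlt h' hno⟩

/-- Starting with a `k`-up of `g`, the entries at positions `ι` zigzag with gaps at least `k`. -/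
def Zig (k : ℤ) (g : Fin n → ℤ) {s : ℕ} (ι : Fin s → Fin n) : Prop :=
  StrictMono ι ∧ ∀ (j : ℕ) (hj : j + 1 < s),
    ((-1) ^ j * g) (ι ⟨j, Nat.lt_of_succ_lt hj⟩) + k ≤ ((-1) ^ j * g) (ι ⟨j + 1, hj⟩)

open Classical in
/-- The `k`-peaks and `k`-valleys. -/
noncomputable def extrema (k : ℤ) (g : Fin n → ℤ) : Finset (Fin n) :=
  Finset.univ.filter fun p => Peak k g p ∨ Peak k (-g) p

lemma mem_extrema {p : Fin n} : p ∈ extrema k g ↔ Peak k g p ∨ Peak k (-g) p := by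
  simp [extrema]

lemma extrema_neg : extrema k (-g) = extrema k g := by
  ext; simp [mem_extrema, or_comm]

lemma extrema_neg_one_pow (j : ℕ) : extrema k ((-1) ^ j * g) = extrema k g := by
  rcases neg_one_pow_eq_or (Fin n → ℤ) j with h | h <;> simp [h, extrema_neg]

lemma MaxAsc.mem_extrema {i j : Fin n} (h : MaxAsc k g i j) :
    i ∈ extrema k g ∧ j ∈ extrema k g := by
  simp only [Zigzag.mem_extrema]
  exact ⟨.inr <| .inr ⟨j, by simpa using h⟩, .inl <| .inl ⟨i, h⟩⟩

lemma Zig.le_card_extrema (hk : 0 < k) (hg : Function.Injective g) {s : ℕ}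
    {ι : Fin (s + 2) → Fin n} (h : Zig k g ι) : s + 2 ≤ (extrema k g).card := by
  have hinj : ∀ j : ℕ, Function.Injective ((-1) ^ j * g) := by
    intro j x y hxy
    rcases neg_one_pow_eq_or (Fin n → ℤ) j with h | h <;> simp [h] at hxy <;> exact hg hxy
  have hsec : ∀ j : ℕ, ∃ A B a b, ∀ hj : j < s + 1, MaxAsc k ((-1) ^ j * g) A B ∧
      Asc k ((-1) ^ j * g) a b ∧ A ≤ a ∧ b ≤ B ∧
      ι ⟨j, by omega⟩ ≤ a ∧ b ≤ ι ⟨j + 1, by omega⟩ := by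
    intro j
    by_cases hj : j < s + 1
    · obtain ⟨a, b, hab, ha, hb⟩ := exists_asc_of_up hk
        (show ι ⟨j, by omega⟩ < ι ⟨j + 1, by omega⟩ from h.1 (by simp)) (h.2 j (by omega))
      obtain ⟨A, B, hAB, hA, hB⟩ := hab.exists_maxAsc
      exact ⟨A, B, a, b, fun _ => ⟨hAB, hab, hA, hB, ha, hb⟩⟩
    · exact ⟨ι 0, ι 0, ι 0, ι 0, fun hj' => absurd hj' hj⟩
  choose A B a b hs using hsec
  have hBA : ∀ j, j + 1 < s + 1 → B j ≤ A (j + 1) := by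
    intro j hj
    obtain ⟨h1, h2, h3, h4, h5, h6⟩ := hs j (by omega)
    obtain ⟨h1', h2', h3', h4', h5', h6'⟩ := hs (j + 1) hj
    have e : ((-1) ^ (j + 1) * g) = -((-1) ^ j * g) := by ring
    rw [e] at h1' h2'
    exact h1.1.le_of_neg (hinj j) h1'.1 h2 h2' h3 h4' (h6.trans h5')
  let f : Fin (s + 2) → Fin n := fun i => Fin.cases (A 0) (fun j : Fin (s + 1) => B j) i
  have hf : StrictMono f := by
    refine Fin.strictMono_iff_lt_succ.2 fun i => ?_
    induction i using Fin.cases with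
    | zero => exact (hs 0 (by omega)).1.1.1
    | succ i =>
      have h1 := hBA i (by omega)
      have h2 := (hs (i + 1) (by omega)).1.1.1
      exact h1.trans_lt h2
  have hmem : ∀ i ∈ Finset.univ, f i ∈ extrema k g := by
    intro i _
    induction i using Fin.cases with
    | zero =>
      have := ((hs 0 (by omega)).1.mem_extrema).1
      rwa [extrema_neg_one_pow] at this
    | succ i =>
      have := ((hs i i.2).1.mem_extrema).2
      rwa [extrema_neg_one_pow] at this
  simpa using Finset.card_le_card_of_injOn f hmem hf.injective.injOn

lemma zig_extrema_of_peak (hk : 0 < k) (hg : Function.Injective g)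
    (h : ∀ h0 : 0 < (extrema k g).card, Peak k (-g) ((extrema k g).orderEmbOfFin rfl ⟨0, h0⟩)) :
    Zig k g ((extrema k g).orderEmbOfFin rfl) := by
  set ι := (extrema k g).orderEmbOfFin rfl with hι
  have hinj : ∀ j : ℕ, Function.Injective (-((-1) ^ j * g)) := by
    intro j x y hxy
    rcases neg_one_pow_eq_or (Fin n → ℤ) j with h | h <;> simp [h] at hxy <;> exact hg hxy
  have hstep : ∀ (j : ℕ) (hj : j + 1 < (extrema k g).card),
      LocalPeak k (-((-1) ^ j * g)) (ι ⟨j, Nat.lt_of_succ_lt hj⟩) →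
      LocalPeak k ((-1) ^ j * g) (ι ⟨j + 1, hj⟩) ∧
      ((-1) ^ j * g) (ι ⟨j, Nat.lt_of_succ_lt hj⟩) + k ≤ ((-1) ^ j * g) (ι ⟨j + 1, hj⟩) := by
    intro j hj hp
    have hiff : ∀ m, m ∈ extrema k g ↔
        LocalPeak k (-((-1) ^ j * g)) m ∨ LocalPeak k (- -((-1) ^ j * g)) m := by
      intro m
      rw [← peak_iff_localPeak hk (hinj j), ← peak_iff_localPeak hk (by
        simpa [pow_succ] using hinj (j + 1)), ← mem_extrema, extrema_neg, extrema_neg_one_pow]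
    have := hp.consecutive hk (hinj j) (e' := ι ⟨j + 1, hj⟩) (ι.strictMono (by simp))
      ((hiff _).1 (Finset.orderEmbOfFin_mem _ _ _)) (fun m hm hm' => by
        rw [← not_or, ← hiff]
        intro hmem
        obtain ⟨i, rfl⟩ : m ∈ Set.range ι := by
          rw [hι, Finset.range_orderEmbOfFin]; exact hmem
        simp only [OrderEmbedding.lt_iff_lt, Fin.lt_def] at hm hm'
        omega)
    rw [neg_neg] at this
    refine ⟨this.1, ?_⟩
    have := this.2
    simp only [Pi.neg_apply] at this
    omega
  have hpeak : ∀ (j : ℕ) (hj : j < (extrema k g).card),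
      LocalPeak k (-((-1) ^ j * g)) (ι ⟨j, hj⟩) := by
    intro j
    induction j with
    | zero => intro hj; simpa using (peak_iff_localPeak hk (by simpa using hinj 0)).1 (h hj)
    | succ j ih =>
      intro hj
      have := (hstep j hj (ih _)).1
      rwa [pow_succ, mul_neg_one, neg_mul, neg_neg]
  exact ⟨ι.strictMono, fun j hj => (hstep j hj (hpeak j _)).2⟩

lemma zig_extrema (hk : 0 < k) (hg : Function.Injective g) :
    Zig k g ((extrema k g).orderEmbOfFin rfl) ∨ Zig k (-g) ((extrema k g).orderEmbOfFin rfl) := by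
  by_cases h0 : 0 < (extrema k g).card
  · rcases mem_extrema.1 ((extrema k g).orderEmbOfFin_mem rfl ⟨0, h0⟩) with h | h
    · right
      have := zig_extrema_of_peak (g := -g) hk (neg_injective.comp hg)
      rw [extrema_neg, neg_neg] at this
      exact this fun _ => h
    · exact .inl (zig_extrema_of_peak hk hg fun _ => h)
  · exact .inl (zig_extrema_of_peak hk hg fun h => absurd h h0)

/-- The one-line notation of a permutation, with integer entries. -/
def values (w : Equiv.Perm (Fin n)) (t : Fin n) : ℤ := (w t : ℕ)

lemma values_injective (w : Equiv.Perm (Fin n)) : Function.Injective (values w) := by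
  intro x y h
  exact w.injective (Fin.ext (by simpa [values] using h))

variable {κ : ℕ} {w : Equiv.Perm (Fin n)}

lemma isKAsc_iff {i j : Fin n} : IsKAsc κ w i j ↔ Asc κ (values w) i j := by
  simp only [IsKAsc, Asc, IsKDown, values, not_and, not_le]
  refine and_congr Iff.rfl (and_congr (by norm_cast) (and_congr (by norm_cast) ?_))
  exact ⟨fun h s t hs hst ht => by exact_mod_cast h s t hs ht hst,
    fun h s t hs ht hst => by exact_mod_cast h s t hs hst ht⟩

lemma isKDesc_iff {i j : Fin n} : IsKDesc κ w i j ↔ Asc κ (-values w) i j := by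
  simp only [IsKDesc, Asc, IsKUp, values, not_and, not_le, Pi.neg_apply]
  refine and_congr Iff.rfl (and_congr ?_ (and_congr (by omega) ?_))
  · exact forall_congr' fun t => by omega
  · exact ⟨fun h s t hs hst ht => by have := h s t hs ht hst; omega,
      fun h s t hs ht hst => by have := h s t hs hst ht; omega⟩

lemma isKPeakPos_iff {p : Fin n} : IsKPeakPos κ w p ↔ Peak κ (values w) p := by
  simp only [IsKPeakPos, Peak, IsMaxKAsc, IsMaxKDesc, MaxAsc, isKAsc_iff, isKDesc_iff]

lemma isKAsc_rev_mul {i j : Fin n} : IsKAsc κ (Fin.revPerm * w) i j ↔ IsKDesc κ w i j := by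
  simp only [IsKAsc, IsKDesc, IsKDown, IsKUp, Equiv.Perm.mul_apply, Fin.revPerm_apply, Fin.val_rev]
  have hw := fun t => (w t).isLt
  refine and_congr Iff.rfl (and_congr ?_ (and_congr ?_ ?_))
  · refine forall_congr' fun t => ?_
    have := hw t; have := hw i; have := hw j
    omega
  · have := hw i; have := hw j
    omega
  · refine forall_congr' fun s => forall_congr' fun t => ?_
    have := hw s; have := hw t
    omega

lemma isKDesc_rev_mul {i j : Fin n} : IsKDesc κ (Fin.revPerm * w) i j ↔ IsKAsc κ w i j := by
  rw [← isKAsc_rev_mul, ← mul_assoc]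
  have : (Fin.revPerm * Fin.revPerm : Equiv.Perm (Fin n)) = 1 := by ext; simp
  rw [this, one_mul]

lemma isKPeakPos_rev_mul {p : Fin n} :
    IsKPeakPos κ (Fin.revPerm * w) p ↔ Peak κ (-values w) p := by
  simp only [IsKPeakPos, IsMaxKAsc, IsMaxKDesc, isKAsc_rev_mul, isKDesc_rev_mul]
  simp only [Peak, MaxAsc, isKAsc_iff, isKDesc_iff, neg_neg]

lemma card_extrema (hκ : 0 < κ) : (extrema κ (values w)).card =
    Nat.card {p // IsKPeakPos κ w p} + Nat.card {p // IsKPeakPos κ (Fin.revPerm * w) p} := by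
  classical
  have hk : (0 : ℤ) < κ := by exact_mod_cast hκ
  have hg := values_injective w
  simp only [isKPeakPos_iff (w := w), isKPeakPos_rev_mul, Nat.card_eq_fintype_card,
    Fintype.card_subtype]
  rw [← Finset.card_union_of_disjoint, ← Finset.filter_or]
  · congr 1
  · refine Finset.disjoint_filter.2 fun p _ h h' => ?_
    exact ((peak_iff_localPeak hk hg).1 h).not_neg hk
      ((peak_iff_localPeak hk (neg_injective.comp hg)).1 h')

lemma isRevAltSeq_and_hasGaps_iff (hκ : 0 < κ) {s : ℕ} {ι : Fin s → Fin n} :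
    IsRevAltSeq w ι ∧ HasGaps κ w ι ↔ Zig κ (values w) ι := by
  simp only [IsRevAltSeq, HasGaps, Zig, and_assoc, ← forall_and]
  refine and_congr Iff.rfl (forall_congr' fun j => forall_congr' fun hj => ?_)
  rcases Nat.even_or_odd j with h | h
  · have h' := Nat.even_iff.1 h
    simp only [h', if_true, h.neg_one_pow, one_mul, values, le_abs]
    omega
  · have h' := Nat.odd_iff.1 h
    simp only [h', one_ne_zero, if_false, h.neg_one_pow, neg_one_mul, Pi.neg_apply, values, le_abs]
    omega

lemma isAltSeq_and_hasGaps_iff (hκ : 0 < κ) {s : ℕ} {ι : Fin s → Fin n} :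
    IsAltSeq w ι ∧ HasGaps κ w ι ↔ Zig κ (-values w) ι := by
  simp only [IsAltSeq, HasGaps, Zig, and_assoc, ← forall_and]
  refine and_congr Iff.rfl (forall_congr' fun j => forall_congr' fun hj => ?_)
  rcases Nat.even_or_odd j with h | h
  · have h' := Nat.even_iff.1 h
    simp only [h', if_true, h.neg_one_pow, one_mul, Pi.neg_apply, values, le_abs]
    omega
  · have h' := Nat.odd_iff.1 h
    simp only [h', one_ne_zero, if_false, h.neg_one_pow, neg_one_mul, neg_neg, values, le_abs]
    omega

lemma two_le_card_extrema (hκ : 0 < κ) (hn : κ + 1 ≤ n) :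
    2 ≤ (extrema κ (values w)).card := by
  have hk : (0 : ℤ) < κ := by exact_mod_cast hκ
  let x := w.symm ⟨0, by omega⟩
  let y := w.symm ⟨n - 1, by omega⟩
  have hx : values w x = 0 := by simp [values, x]
  have hy : values w y = (n - 1 : ℕ) := by simp [values, y]
  have key : ∀ g : Fin n → ℤ, ∀ {s t : Fin n}, s < t → g s + κ ≤ g t →
      2 ≤ (extrema κ g).card := by
    intro g s t hst h
    obtain ⟨a, b, hab, -⟩ := exists_asc_of_up hk hst h
    obtain ⟨A, B, hAB, -⟩ := hab.exists_maxAsc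
    exact Finset.one_lt_card.2 ⟨A, hAB.mem_extrema.1, B, hAB.mem_extrema.2, hAB.1.1.ne⟩
  rcases lt_trichotomy x y with h | h | h
  · exact key _ h (by omega)
  · rw [h] at hx
    omega
  · rw [← extrema_neg]
    exact key _ h (by simp only [Pi.neg_apply]; omega)

lemma kZigLen_eq_card_extrema (hκ : 0 < κ) (hn : κ + 1 ≤ n) :
    kZigLen n κ w = (extrema κ (values w)).card := by
  have hk : (0 : ℤ) < κ := by exact_mod_cast hκ
  have hg := values_injective w
  simp only [kZigLen, or_and_right, isAltSeq_and_hasGaps_iff hκ, isRevAltSeq_and_hasGaps_iff hκ]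
  refine IsGreatest.csSup_eq ⟨⟨_, (zig_extrema hk hg).symm⟩, ?_⟩
  rintro s ⟨ι, h⟩
  rcases s with _ | _ | s
  · exact Nat.zero_le _
  · exact (Nat.le_succ 1).trans (two_le_card_extrema hκ hn)
  · rcases h with h | h
    · rw [← extrema_neg]
      exact h.le_card_extrema hk (neg_injective.comp hg)
    · exact h.le_card_extrema hk hg

end Zigzag

/-- `Σ_w zs_k(w) = 2 · Σ_w #{k-peaks of w}`: the average `k`-zigzagging length is twice
the average number of `k`-peaks. -/
theorem sum_zig_eq_two_mul_sum_peaks (n k : ℕ) (hk : 2 ≤ k + 1) (hkn : k + 1 ≤ n) :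
    ∑ w : Equiv.Perm (Fin n), kZigLen n k w =
      2 * ∑ w : Equiv.Perm (Fin n), Nat.card {p : Fin n // IsKPeakPos k w p} := by
  have hκ : 0 < k := by omega
  have hrev := Equiv.sum_comp (Equiv.mulLeft (Fin.revPerm : Equiv.Perm (Fin n)))
    fun w => Nat.card {p // IsKPeakPos k w p}
  simp only [Equiv.coe_mulLeft] at hrev
  simp only [Zigzag.kZigLen_eq_card_extrema hκ hkn, Zigzag.card_extrema hκ,
    Finset.sum_add_distrib, hrev, two_mul]
end

section
/- Let w = w_1 ⋯ w_n be a permutation of {1,…,n}, let 1 ≤ i ≤ n and 1 ≤ k ≤ n-1. Then w_i is a k-peak of w if and only if both of the following hold: (1) whenever there is an index s > i with w_s > w_i, there is an index j with i < j ≤ s and w_i - w_j ≥ k (a k-down w_i ⋯ w_j inside w_i ⋯ w_s); and (2) whenever there is an index s < i with w_s > w_i, there is an index j with s ≤ j < i and w_i - w_j ≥ k (a k-up w_j ⋯ w_i inside w_s ⋯ w_i). -/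
open Nat

theorem isKAsc_revPerm_trans {n k : ℕ} {w : Equiv.Perm (Fin n)} {i j : Fin n} :
    IsKAsc k (Fin.revPerm.trans w) i j ↔ IsKDesc k w j.rev i.rev := by
  simp only [IsKAsc, IsKDesc, IsKDown, IsKUp, Equiv.trans_apply, Fin.revPerm_apply,
    Fin.rev_lt_rev]
  refine and_congr_right fun _ => and_congr ?_ (and_congr_right fun _ => ?_)
  · rw [Fin.revPerm.forall_congr_left]
    refine forall_congr' fun t => ?_
    simp only [Fin.revPerm_symm, Fin.revPerm_apply, Fin.rev_rev]
    rw [Fin.le_rev_iff, Fin.rev_le_iff]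
    tauto
  · constructor
    · intro h s t hs ht hst
      refine h t.rev s.rev (Fin.le_rev_iff.2 ht) (Fin.rev_le_iff.2 hs) ?_
      simpa using hst
    · intro h s t hs ht hst
      refine h t.rev s.rev (Fin.rev_le_rev.2 ht) (Fin.rev_le_rev.2 hs) ?_
      simpa using hst

theorem isMaxKAsc_revPerm_trans {n k : ℕ} {w : Equiv.Perm (Fin n)} {i j : Fin n} :
    IsMaxKAsc k (Fin.revPerm.trans w) i j ↔ IsMaxKDesc k w j.rev i.rev := by
  simp only [IsMaxKAsc, IsMaxKDesc, isKAsc_revPerm_trans]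
  refine and_congr_right fun _ => ⟨fun h a b hab ha hb => ?_, fun h a b hab ha hb => ?_⟩
  · have := h b.rev a.rev (by simpa using hab) (Fin.rev_le_iff.2 hb) (Fin.le_rev_iff.2 ha)
    simpa [Fin.rev_eq_iff, and_comm] using this
  · have := h b.rev a.rev hab (Fin.rev_le_rev.2 hb) (Fin.rev_le_rev.2 ha)
    simpa [and_comm] using this

/-- The right end of a maximal `k`-ascending section is separated from every larger entry to its
right by an entry that is smaller by at least `k`. -/
theorem IsMaxKAsc.exists_add_le_of_lt_right {n k : ℕ} {w : Equiv.Perm (Fin n)} {a i s : Fin n}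
    (h : IsMaxKAsc k w a i) (his : i < s) (hs : (w i : ℕ) < w s) :
    ∃ j : Fin n, i < j ∧ j ≤ s ∧ (w j : ℕ) + k ≤ w i := by
  obtain ⟨⟨hai, hb, hk, hd⟩, hmax⟩ := h
  by_contra! hno
  induction s using WellFoundedLT.induction with
  | ind s ih =>
  have hle : ∀ t, i < t → t < s → (w t : ℕ) ≤ w i := fun t hit hts => by
    by_contra! hlt
    exact ih t hts hit hlt fun j hij hjt => hno j hij (hjt.trans hts.le)
  refine his.ne' (hmax a s ⟨hai.trans his, fun t hat hts => ?_, by omega, ?_⟩ le_rfl his.le).2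
  · rcases le_or_gt t i with hti | hit
    · have := hb t hat hti
      omega
    · have := hno t hit hts
      rcases hts.eq_or_lt with rfl | hts
      · omega
      · have := hle t hit hts
        omega
  · rintro u v hau hvs ⟨huv, hdown⟩
    rcases le_or_gt v i with hvi | hiv
    · exact hd u v hau hvi ⟨huv, hdown⟩
    · have hv := hno v hiv hvs
      have hu : (w u : ℕ) ≤ w i := by
        rcases le_or_gt u i with hui | hiu
        · exact (hb u hau hui).2
        · exact hle u hiu (huv.trans_le hvs)
      omega

/-- The right end of a maximal `k`-ascending section is separated from every larger entry to its
left by an entry that is smaller by at least `k`. -/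
theorem IsKAsc.exists_add_le_of_lt_left {n k : ℕ} {w : Equiv.Perm (Fin n)} {a i s : Fin n}
    (h : IsKAsc k w a i) (hsi : s < i) (hs : (w i : ℕ) < w s) :
    ∃ j : Fin n, s ≤ j ∧ j < i ∧ (w j : ℕ) + k ≤ w i := by
  obtain ⟨hai, hb, hk, -⟩ := h
  refine ⟨a, ?_, hai, hk⟩
  by_contra! has
  have := (hb s has.le hsi.le).2
  omega

/-- If `w i` is separated from every larger entry by an entry that is smaller by at least `k`, and
some entry to its left is smaller by at least `k`, then a maximal `k`-ascending section ends
at `i`. -/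
theorem exists_isMaxKAsc {n k : ℕ} {w : Equiv.Perm (Fin n)} {i : Fin n}
    (hr : ∀ s : Fin n, i < s → (w i : ℕ) < w s → ∃ j, i < j ∧ j ≤ s ∧ (w j : ℕ) + k ≤ w i)
    (hl : ∀ s : Fin n, s < i → (w i : ℕ) < w s → ∃ j, s ≤ j ∧ j < i ∧ (w j : ℕ) + k ≤ w i)
    (h : ∃ j < i, (w j : ℕ) + k ≤ w i) : ∃ a, IsMaxKAsc k w a i := by
  obtain ⟨b, hb, hbmax⟩ := (Set.toFinite {j | j < i ∧ (w j : ℕ) + k ≤ w i}).exists_maximal h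
  have hsmall : ∀ t, b < t → t < i → (w i : ℕ) < w t + k := fun t hbt hti => by
    by_contra! hle
    exact (hbmax ⟨hti, hle⟩ hbt.le).not_gt hbt
  have hbi : IsKAsc k w b i := by
    have hle : ∀ t, b < t → t < i → (w t : ℕ) ≤ w i := fun t hbt hti => by
      by_contra! hlt
      obtain ⟨j, htj, hji, hj⟩ := hl t hti hlt
      have := hsmall j (hbt.trans_le htj) hji
      omega
    have hbounds : ∀ t, b ≤ t → t ≤ i → (w b : ℕ) ≤ w t ∧ (w t : ℕ) ≤ w i := fun t hbt hti => by
      have := hb.2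
      rcases hbt.eq_or_lt with rfl | hbt
      · omega
      rcases hti.eq_or_lt with rfl | hti
      · omega
      have := hle t hbt hti
      have := hsmall t hbt hti
      omega
    refine ⟨hb.1, hbounds, hb.2, ?_⟩
    rintro u v hbu hvi ⟨huv, hdown⟩
    have hne : (w u : ℕ) ≠ w v := fun e => huv.ne (w.injective (Fin.ext e))
    have hu := hbounds u hbu (huv.le.trans hvi)
    rcases hvi.eq_or_lt with rfl | hvi
    · omega
    · have := hsmall v (hbu.trans_lt huv) hvi
      omega
  obtain ⟨a, ha, hamin⟩ := (Set.toFinite {a | IsKAsc k w a i}).exists_minimal ⟨b, hbi⟩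
  refine ⟨a, ha, fun a' j ha' haa' hij => ?_⟩
  have hji : j = i := by
    by_contra hne
    have hij : i < j := lt_of_le_of_ne hij (Ne.symm hne)
    have hai : a' < i := haa'.trans_lt ha.1
    have hwij : (w i : ℕ) < w j := lt_of_le_of_ne (ha'.2.1 i hai.le hij.le).2 fun e =>
      hij.ne (w.injective (Fin.ext e))
    obtain ⟨t, hit, htj, ht⟩ := hr j hij hwij
    exact ha'.2.2.2 i t hai.le htj ⟨hit, ht⟩
  subst hji
  exact ⟨le_antisymm haa' (hamin ha' haa'), rfl⟩

/-- Characterization of `k`-peaks: `w_i` is a `k`-peak iff (1) whenever `w_s > w_i` for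
some `s > i` there is a `k`-down `w_i ⋯ w_j` inside `w_i ⋯ w_s`, and (2) whenever
`w_s > w_i` for some `s < i` there is a `k`-up `w_j ⋯ w_i` inside `w_s ⋯ w_i`. -/
theorem kPeak_characterization (n k : ℕ) (hn : 2 ≤ n) (hk : 1 ≤ k) (hkn : k ≤ n - 1)
    (w : Equiv.Perm (Fin n)) (i : Fin n) :
    IsKPeakPos k w i ↔
      ((∀ s : Fin n, i < s → (w i : ℕ) < (w s : ℕ) →
          ∃ j : Fin n, i < j ∧ j ≤ s ∧ (w j : ℕ) + k ≤ (w i : ℕ)) ∧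
       (∀ s : Fin n, s < i → (w i : ℕ) < (w s : ℕ) →
          ∃ j : Fin n, s ≤ j ∧ j < i ∧ (w j : ℕ) + k ≤ (w i : ℕ))) := by
  have hrev : ∀ a b : Fin n, IsMaxKDesc k w a b ↔
      IsMaxKAsc k (Fin.revPerm.trans w) b.rev a.rev := fun a b => by
    rw [isMaxKAsc_revPerm_trans, Fin.rev_rev, Fin.rev_rev]
  constructor
  · rintro (⟨a, ha⟩ | ⟨b, hb⟩)
    · exact ⟨fun s => ha.exists_add_le_of_lt_right, fun s => ha.1.exists_add_le_of_lt_left⟩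
    · rw [hrev] at hb
      constructor
      · intro s his hs
        obtain ⟨j, hsj, hji, hj⟩ :=
          hb.1.exists_add_le_of_lt_left (Fin.rev_lt_rev.2 his) (by simpa using hs)
        exact ⟨j.rev, Fin.lt_rev_iff.2 hji, Fin.rev_le_iff.2 hsj, by simpa using hj⟩
      · intro s hsi hs
        obtain ⟨j, hij, hjs, hj⟩ :=
          hb.exists_add_le_of_lt_right (Fin.rev_lt_rev.2 hsi) (by simpa using hs)
        exact ⟨j.rev, Fin.le_rev_iff.2 hjs, Fin.rev_lt_iff.2 hij, by simpa using hj⟩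
  · rintro ⟨hr, hl⟩
    by_cases hleft : ∃ j < i, (w j : ℕ) + k ≤ w i
    · exact Or.inl (exists_isMaxKAsc hr hl hleft)
    have hright : ∃ j, i < j ∧ (w j : ℕ) + k ≤ w i := by
      by_contra! hright
      push Not at hleft
      have hmax : ∀ s, (w s : ℕ) ≤ w i := fun s => by
        by_contra! hs
        rcases lt_trichotomy s i with hsi | rfl | his
        · obtain ⟨j, -, hji, hj⟩ := hl s hsi hs
          exact (hleft j hji).not_ge hj
        · exact hs.false
        · obtain ⟨j, hij, -, hj⟩ := hr s his hs
          exact (hright j hij).not_ge hj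
      have hlast := hmax (w.symm ⟨n - 1, by omega⟩)
      obtain ⟨z, hz⟩ := w.surjective ⟨0, by omega⟩
      have hz : (w z : ℕ) = 0 := congrArg Fin.val hz
      rw [Equiv.apply_symm_apply, Fin.val_mk] at hlast
      rcases lt_trichotomy z i with hzi | rfl | hiz
      · have := hleft z hzi
        omega
      · omega
      · have := hright z hiz
        omega
    obtain ⟨j, hij, hj⟩ := hright
    obtain ⟨a, ha⟩ := exists_isMaxKAsc (k := k) (w := Fin.revPerm.trans w) (i := i.rev)
      (fun s his hs => by
        obtain ⟨t, hst, hti, ht⟩ := hl s.rev (Fin.rev_lt_iff.2 his) (by simpa using hs)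
        exact ⟨t.rev, Fin.rev_lt_rev.2 hti, Fin.rev_le_iff.2 hst, by simpa using ht⟩)
      (fun s hsi hs => by
        obtain ⟨t, hit, hts, ht⟩ := hr s.rev (Fin.lt_rev_iff.2 hsi) (by simpa using hs)
        exact ⟨t.rev, Fin.le_rev_iff.2 hts, Fin.rev_lt_rev.2 hit, by simpa using ht⟩)
      ⟨j.rev, Fin.rev_lt_rev.2 hij, by simpa using hj⟩
    exact Or.inr ⟨a.rev, (hrev i a.rev).2 (by rwa [Fin.rev_rev])⟩
end

section
/- Let w ∈ S_n and let 1 ≤ k' ≤ k ≤ n-1. If w_i is a k-peak of w, then w_i is also a k'-peak of w. -/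
open Nat

/-- Left of the top of a maximal `k`-descending section, a larger value can only be found
behind a value smaller by at least `k` than that top. -/
theorem IsMaxKDesc.exists_drop {n k : ℕ} {w : Equiv.Perm (Fin n)} {p j : Fin n}
    (h : IsMaxKDesc k w p j) {t : Fin n} (htp : t < p) (hwt : (w p : ℕ) < (w t : ℕ)) :
    ∃ s : Fin n, t < s ∧ s < p ∧ (w s : ℕ) + k ≤ (w p : ℕ) := by
  by_contra! hno
  obtain ⟨⟨hpj, hbd, hgap, hup⟩, hmax⟩ := h
  obtain ⟨u, hu, humax⟩ := (Finset.univ.filter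
    fun u : Fin n => t ≤ u ∧ u < p ∧ (w p : ℕ) < (w u : ℕ)).exists_maximal
      ⟨t, by simpa using ⟨htp, hwt⟩⟩
  simp only [Finset.mem_filter, Finset.mem_univ, true_and] at hu humax
  obtain ⟨htu, hulp, hwu⟩ := hu
  have hmid : ∀ s : Fin n, u < s → s < p →
      (w p : ℕ) < (w s : ℕ) + k ∧ (w s : ℕ) ≤ (w p : ℕ) := by
    intro s hus hsp
    refine ⟨hno s (htu.trans_lt hus) hsp, ?_⟩
    by_contra! hws
    exact absurd (humax ⟨htu.trans hus.le, hsp, hws⟩ hus.le) (not_le.mpr hus)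
  have hdesc : IsKDesc k w u j := by
    refine ⟨hulp.trans hpj, fun s hus hsj => ?_, by omega, fun a b hua hbj hab => ?_⟩
    · rcases hus.eq_or_lt with rfl | hus
      · omega
      · rcases lt_or_ge s p with hsp | hps
        · have := hmid s hus hsp
          omega
        · have := hbd s hps hsj
          omega
    · rcases lt_or_ge a p with hap | hpa
      · have hb : (w b : ℕ) ≤ (w p : ℕ) := by
          rcases lt_or_ge b p with hbp | hpb
          · exact (hmid b (hua.trans_lt hab.1) hbp).2
          · exact (hbd b hpb hbj).1
        have hwab := hab.2
        rcases hua.eq_or_lt with rfl | hua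
        · omega
        · have := (hmid a hua hap).1
          omega
      · exact hup a b hpa hbj hab
  exact hulp.ne (hmax u j hdesc hulp.le le_rfl).1

/-- The left end of a maximal `k`-descending section is also the left end of a maximal
`k'`-descending section for `1 ≤ k' ≤ k`. -/
theorem IsMaxKDesc.exists_of_le {n k k' : ℕ} {w : Equiv.Perm (Fin n)} {p j : Fin n}
    (h : IsMaxKDesc k w p j) (hk' : 1 ≤ k') (hk'k : k' ≤ k) :
    ∃ j', IsMaxKDesc k' w p j' := by
  obtain ⟨hpj, hbd, hgap, -⟩ := h.1
  obtain ⟨s, hs, hsmin⟩ := (Finset.univ.filter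
    fun s : Fin n => p < s ∧ s ≤ j ∧ (w s : ℕ) + k' ≤ (w p : ℕ)).exists_minimal
      ⟨j, by simpa using ⟨hpj, by omega⟩⟩
  simp only [Finset.mem_filter, Finset.mem_univ, true_and] at hs hsmin
  obtain ⟨hps, hsj, hws⟩ := hs
  have hmid : ∀ t : Fin n, p ≤ t → t < s →
      (w p : ℕ) < (w t : ℕ) + k' ∧ (w t : ℕ) ≤ (w p : ℕ) := by
    intro t hpt hts
    refine ⟨?_, (hbd t hpt (hts.le.trans hsj)).1⟩
    rcases hpt.eq_or_lt with rfl | hpt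
    · omega
    · by_contra! hwt
      exact absurd (hsmin ⟨hpt, hts.le.trans hsj, hwt⟩ hts.le) (not_le.mpr hts)
  have hdesc : IsKDesc k' w p s := by
    refine ⟨hps, fun t hpt hts => ?_, hws, fun a b hpa hbs hab => ?_⟩
    · rcases hts.eq_or_lt with rfl | hts
      · omega
      · have := hmid t hpt hts
        omega
    · have ha := (hmid a hpa (hab.1.trans_le hbs)).1
      have hwab := hab.2
      rcases hbs.eq_or_lt with rfl | hbs
      · omega
      · have := (hmid b (hpa.trans hab.1.le) hbs).2
        omega
  obtain ⟨m, hm, hmmax⟩ := (Set.toFinite {m : Fin n | IsKDesc k' w p m}).exists_maximal ⟨s, hdesc⟩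
  refine ⟨m, hm, fun a b hab hap hmb => ?_⟩
  obtain rfl : a = p := by
    by_contra hne
    have hlt := lt_of_le_of_ne hap hne
    have hle := (hab.2.1 p hap (hm.1.le.trans hmb)).1
    have hwne : (w p : ℕ) ≠ (w a : ℕ) := fun he =>
      hne (w.injective (Fin.ext he)).symm
    obtain ⟨c, hac, hcp, hwc⟩ := h.exists_drop hlt (by omega)
    exact hab.2.2.2 c p hac.le (hm.1.le.trans hmb) ⟨hcp, by omega⟩
  exact ⟨rfl, le_antisymm (hmmax hab hmb) hmb⟩

/-- Reading `w` backwards exchanges `k`-ascending and `k`-descending sections. -/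
theorem isKDesc_revPerm_trans {n k : ℕ} {w : Equiv.Perm (Fin n)} {i j : Fin n} :
    IsKDesc k (Fin.revPerm.trans w) i j ↔ IsKAsc k w j.rev i.rev := by
  simp only [IsKDesc, IsKAsc, IsKUp, IsKDown, Equiv.trans_apply, Fin.revPerm_apply,
    Fin.rev_lt_rev]
  refine and_congr_right fun _ => and_congr ?_ (and_congr_right fun _ => ?_)
  · constructor
    · intro h t h1 h2
      simpa using (h t.rev (Fin.le_rev_iff.mp h2) (Fin.rev_le_iff.mp h1)).symm
    · intro h t h1 h2
      exact (h t.rev (Fin.rev_le_rev.mpr h2) (Fin.rev_le_rev.mpr h1)).symm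
  · constructor
    · intro h s t h1 h2 h3
      exact h t.rev s.rev (Fin.le_rev_iff.mp h2) (Fin.rev_le_iff.mp h1)
        (by simpa using h3)
    · intro h s t h1 h2 h3
      exact h t.rev s.rev (Fin.rev_le_rev.mpr h2) (Fin.rev_le_rev.mpr h1)
        (by simpa using h3)

/-- Reading `w` backwards exchanges maximal `k`-ascending and `k`-descending sections. -/
theorem isMaxKDesc_revPerm_trans {n k : ℕ} {w : Equiv.Perm (Fin n)} {i j : Fin n} :
    IsMaxKDesc k (Fin.revPerm.trans w) i j ↔ IsMaxKAsc k w j.rev i.rev := by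
  simp only [IsMaxKDesc, IsMaxKAsc, isKDesc_revPerm_trans]
  refine and_congr_right fun _ => ?_
  constructor
  · intro h a b hab h1 h2
    obtain ⟨rfl, rfl⟩ := h b.rev a.rev (by simpa only [Fin.rev_rev] using hab)
      (Fin.rev_le_iff.mpr h2) (Fin.le_rev_iff.mpr h1)
    simp only [Fin.rev_rev, and_self]
  · intro h a b hab h1 h2
    obtain ⟨e1, e2⟩ := h b.rev a.rev hab (Fin.rev_le_rev.mpr h2) (Fin.rev_le_rev.mpr h1)
    exact ⟨Fin.rev_injective e2, Fin.rev_injective e1⟩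

/-- A `k`-peak is also a `k'`-peak whenever `1 ≤ k' ≤ k ≤ n-1`. -/
theorem kPeak_mono (n k k' : ℕ) (hn : 2 ≤ n) (hk' : 1 ≤ k') (hk'k : k' ≤ k)
    (hkn : k ≤ n - 1) (w : Equiv.Perm (Fin n)) (i : Fin n)
    (h : IsKPeakPos k w i) :
    IsKPeakPos k' w i := by
  rcases h with ⟨j, hj⟩ | ⟨j, hj⟩
  · have hrev : IsMaxKDesc k (Fin.revPerm.trans w) i.rev j.rev := by
      simpa only [isMaxKDesc_revPerm_trans, Fin.rev_rev] using hj
    obtain ⟨j', hj'⟩ := hrev.exists_of_le hk' hk'k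
    refine Or.inl ⟨j'.rev, ?_⟩
    simpa only [isMaxKDesc_revPerm_trans, Fin.rev_rev] using hj'
  · exact Or.inr (hj.exists_of_le hk' hk'k)
end

section
/- Let n ≥ k+1 ≥ 2 and let j be an integer with k < j ≤ n. Then the number of permutations w ∈ S_n in which the value j is a k-peak equals n! · (j-k)(j-k+1) / ((n-k)(n-k+1)); that is, (n-k)(n-k+1) · #{w ∈ S_n : j is a k-peak of w} = (j-k)(j-k+1) · n!. -/
open Nat

open Finset in
/-- Counting a disjoint union of equinumerous events. -/
theorem card_filter_exists_mem_eq_mul {α β : Type*} [Fintype β] (T : Finset α)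
    (P : α → β → Prop) (c : ℕ)
    (huniq : ∀ b, ∀ x ∈ T, ∀ y ∈ T, P x b → P y b → x = y)
    (hcard : ∀ x ∈ T, Nat.card {b // P x b} = c) :
    Nat.card {b // ∃ x ∈ T, P x b} = #T * c := by
  classical
  have h : (univ.filter fun b => ∃ x ∈ T, P x b) =
      T.biUnion fun x => univ.filter (P x) := by
    ext b; simp
  rw [Nat.card_eq_fintype_card, Fintype.card_subtype, h, card_biUnion]
  · rw [sum_const_nat]
    intro x hx
    rw [← hcard x hx, Nat.card_eq_fintype_card, Fintype.card_subtype]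
  · intro x hx y hy hxy
    rw [Function.onFun, disjoint_left]
    intro b hb hb'
    simp only [mem_filter, mem_univ, true_and] at hb hb'
    exact hxy (huniq b x hx y hy hb hb')

theorem Nat.card_subtype_or_of_disjoint {β : Type*} [Finite β] (P Q : β → Prop)
    (h : ∀ b, P b → ¬ Q b) :
    Nat.card {b // P b ∨ Q b} = Nat.card {b // P b} + Nat.card {b // Q b} := by
  classical
  have := Fintype.ofFinite β
  simp only [Nat.card_eq_fintype_card]
  refine Fintype.card_subtype_or_disjoint P Q ?_
  rw [Pi.disjoint_iff]
  intro b
  rw [Prop.disjoint_iff]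
  exact not_and.2 (h b)

theorem perm_inv_apply_apply {α : Type*} (σ : Equiv.Perm α) (x : α) : σ⁻¹ (σ x) = x :=
  σ.symm_apply_apply x

section Neighbours

variable {n : ℕ}

/-- Read `σ` as the assignment of positions to letters: `x` is the last letter of `X`
standing before the letter `v`. -/
def IsLeftNbr (X : Finset (Fin n)) (v x : Fin n) (σ : Equiv.Perm (Fin n)) : Prop :=
  x ∈ X ∧ σ x < σ v ∧ ∀ y ∈ X, σ y < σ v → σ y ≤ σ x

/-- `x` is the first letter of `X` standing after the letter `v`. -/
def IsRightNbr (X : Finset (Fin n)) (v x : Fin n) (σ : Equiv.Perm (Fin n)) : Prop :=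
  x ∈ X ∧ σ v < σ x ∧ ∀ y ∈ X, σ v < σ y → σ x ≤ σ y

/-- The letter `v` stands before all letters of `X`. -/
def IsFirst (X : Finset (Fin n)) (v : Fin n) (σ : Equiv.Perm (Fin n)) : Prop :=
  ∀ y ∈ X, σ v < σ y

/-- The letter `v` stands after all letters of `X`. -/
def IsLast (X : Finset (Fin n)) (v : Fin n) (σ : Equiv.Perm (Fin n)) : Prop :=
  ∀ y ∈ X, σ y < σ v

theorem IsLeftNbr.eq {X : Finset (Fin n)} {v x y : Fin n} {σ : Equiv.Perm (Fin n)}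
    (hx : IsLeftNbr X v x σ) (hy : IsLeftNbr X v y σ) : x = y :=
  σ.injective (le_antisymm (hy.2.2 x hx.1 hx.2.1) (hx.2.2 y hy.1 hy.2.1))

theorem IsRightNbr.eq {X : Finset (Fin n)} {v x y : Fin n} {σ : Equiv.Perm (Fin n)}
    (hx : IsRightNbr X v x σ) (hy : IsRightNbr X v y σ) : x = y :=
  σ.injective (le_antisymm (hx.2.2 y hy.1 hy.2.1) (hy.2.2 x hx.1 hx.2.1))

theorem exists_isLeftNbr_iff {X : Finset (Fin n)} {v : Fin n} (hv : v ∉ X)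
    (σ : Equiv.Perm (Fin n)) : (∃ x ∈ X, IsLeftNbr X v x σ) ↔ ¬ IsFirst X v σ := by
  constructor
  · rintro ⟨x, hx, hl⟩ h
    exact lt_asymm (h x hx) hl.2.1
  · intro h
    simp only [IsFirst, not_forall, not_lt] at h
    obtain ⟨z, hz, hzv⟩ := h
    have hlt : σ z < σ v := lt_of_le_of_ne hzv fun h => hv (σ.injective h ▸ hz)
    obtain ⟨x, hx, hmax⟩ := (X.filter fun y => σ y < σ v).exists_max_image σ
      ⟨z, by simp [hz, hlt]⟩
    simp only [Finset.mem_filter] at hx hmax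
    exact ⟨x, hx.1, hx.1, hx.2, fun y hy hyv => hmax y ⟨hy, hyv⟩⟩

theorem isLeftNbr_revPerm_mul {X : Finset (Fin n)} {v x : Fin n} {σ : Equiv.Perm (Fin n)} :
    IsLeftNbr X v x (Fin.revPerm * σ) ↔ IsRightNbr X v x σ := by
  simp [IsLeftNbr, IsRightNbr, Fin.rev_lt_rev, Fin.rev_le_rev]

theorem isRightNbr_revPerm_mul {X : Finset (Fin n)} {v x : Fin n} {σ : Equiv.Perm (Fin n)} :
    IsRightNbr X v x (Fin.revPerm * σ) ↔ IsLeftNbr X v x σ := by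
  simp [IsLeftNbr, IsRightNbr, Fin.rev_lt_rev, Fin.rev_le_rev]

theorem isFirst_revPerm_mul {X : Finset (Fin n)} {v : Fin n} {σ : Equiv.Perm (Fin n)} :
    IsFirst X v (Fin.revPerm * σ) ↔ IsLast X v σ := by
  simp [IsFirst, IsLast, Fin.rev_lt_rev]

theorem exists_isRightNbr_iff {X : Finset (Fin n)} {v : Fin n} (hv : v ∉ X)
    (σ : Equiv.Perm (Fin n)) : (∃ x ∈ X, IsRightNbr X v x σ) ↔ ¬ IsLast X v σ := by
  simp only [← isLeftNbr_revPerm_mul, ← isFirst_revPerm_mul]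
  exact exists_isLeftNbr_iff hv (Fin.revPerm * σ)

theorem swap_mem_iff {α : Type*} [DecidableEq α] {X : Finset α} {a b : α} (ha : a ∈ X)
    (hb : b ∈ X) (y : α) : Equiv.swap a b y ∈ X ↔ y ∈ X := by
  rw [Equiv.swap_apply_def]
  split_ifs <;> simp_all

theorem forall_mem_swap {α : Type*} [DecidableEq α] {X : Finset α} {a b : α} (ha : a ∈ X)
    (hb : b ∈ X) (p : α → Prop) : (∀ y ∈ X, p (Equiv.swap a b y)) ↔ ∀ y ∈ X, p y := by
  constructor
  · intro h y hy
    simpa using h (Equiv.swap a b y) ((swap_mem_iff ha hb y).2 hy)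
  · intro h y hy
    exact h _ ((swap_mem_iff ha hb y).2 hy)

section Swap

variable {X : Finset (Fin n)} {v a b : Fin n}

theorem swap_apply_of_notMem (hv : v ∉ X) (ha : a ∈ X) (hb : b ∈ X) : Equiv.swap a b v = v :=
  Equiv.swap_apply_of_ne_of_ne (fun h => hv (h ▸ ha)) (fun h => hv (h ▸ hb))

theorem isLeftNbr_mul_swap (hv : v ∉ X) (ha : a ∈ X) (hb : b ∈ X)
    {x : Fin n} {σ : Equiv.Perm (Fin n)} :
    IsLeftNbr X v x (σ * Equiv.swap a b) ↔ IsLeftNbr X v (Equiv.swap a b x) σ := by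
  simp only [IsLeftNbr, Equiv.Perm.mul_apply, swap_apply_of_notMem hv ha hb,
    swap_mem_iff ha hb]
  rw [forall_mem_swap ha hb (fun y => σ y < σ v → σ y ≤ σ (Equiv.swap a b x))]

theorem isRightNbr_mul_swap (hv : v ∉ X) (ha : a ∈ X) (hb : b ∈ X)
    {x : Fin n} {σ : Equiv.Perm (Fin n)} :
    IsRightNbr X v x (σ * Equiv.swap a b) ↔ IsRightNbr X v (Equiv.swap a b x) σ := by
  simp only [IsRightNbr, Equiv.Perm.mul_apply, swap_apply_of_notMem hv ha hb,
    swap_mem_iff ha hb]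
  rw [forall_mem_swap ha hb (fun y => σ v < σ y → σ (Equiv.swap a b x) ≤ σ y)]

theorem isFirst_mul_swap (hv : v ∉ X) (ha : a ∈ X) (hb : b ∈ X)
    {σ : Equiv.Perm (Fin n)} :
    IsFirst X v (σ * Equiv.swap a b) ↔ IsFirst X v σ := by
  simp only [IsFirst, Equiv.Perm.mul_apply, swap_apply_of_notMem hv ha hb]
  rw [forall_mem_swap ha hb (fun y => σ v < σ y)]

end Swap

theorem card_mul_right {G : Type*} [Group G] (g : G) (P Q : G → Prop)
    (h : ∀ x, P x ↔ Q (x * g)) : Nat.card {x // P x} = Nat.card {x // Q x} :=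
  Nat.card_congr ((Equiv.mulRight g).subtypeEquiv h)

theorem card_mul_left {G : Type*} [Group G] (g : G) (P Q : G → Prop)
    (h : ∀ x, P x ↔ Q (g * x)) : Nat.card {x // P x} = Nat.card {x // Q x} :=
  Nat.card_congr ((Equiv.mulLeft g).subtypeEquiv h)

section Count

variable {X : Finset (Fin n)} {v : Fin n}

open Finset

theorem card_isFirst (hv : v ∉ X) : (#X + 1) * Nat.card {σ // IsFirst X v σ} = n ! := by
  have key := card_filter_exists_mem_eq_mul (insert v X)
    (fun (s : Fin n) (σ : Equiv.Perm (Fin n)) => ∀ y ∈ insert v X, σ s ≤ σ y)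
    (Nat.card {σ // IsFirst X v σ})
    (fun σ x hx y hy h h' => σ.injective (le_antisymm (h y hy) (h' x hx))) ?_
  · rw [card_insert_of_notMem hv] at key
    rw [← key]
    have : ∀ σ : Equiv.Perm (Fin n),
        ∃ x ∈ insert v X, ∀ y ∈ insert v X, σ x ≤ σ y := fun σ =>
      (insert v X).exists_min_image σ (insert_nonempty v X)
    rw [Nat.card_congr (Equiv.subtypeUnivEquiv this), Nat.card_perm, Nat.card_fin]
  · intro s hs
    refine card_mul_right (Equiv.swap v s) _ _ fun σ => ?_
    have hvm : v ∈ insert v X := mem_insert_self v X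
    rw [← forall_mem_swap hvm hs (fun y => σ s ≤ σ y)]
    simp only [IsFirst, mem_insert, forall_eq_or_imp, Equiv.Perm.mul_apply,
      Equiv.swap_apply_left, le_refl, true_and]
    refine forall₂_congr fun y hy => ?_
    rw [le_iff_lt_or_eq, or_iff_left]
    intro h
    have h2 : Equiv.swap v s y = Equiv.swap v s v := by
      rw [Equiv.swap_apply_left]; exact (σ.injective h).symm
    exact hv ((Equiv.swap v s).injective h2 ▸ hy)

theorem card_isRightNbr (hv : v ∉ X) {y : Fin n} (hy : y ∈ X) :
    Nat.card {σ // IsRightNbr X v y σ} = Nat.card {σ // IsFirst X v σ} := by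
  have key := card_filter_exists_mem_eq_mul X (IsRightNbr X v)
    (Nat.card {σ // IsRightNbr X v y σ}) (fun σ x _ y _ h h' => h.eq h')
    (fun x hx => card_mul_right (Equiv.swap x y) _ _ fun σ => by
      rw [isRightNbr_mul_swap hv hx hy, Equiv.swap_apply_right])
  have tot := Nat.card_subtype_or_of_disjoint (fun σ => ∃ x ∈ X, IsRightNbr X v x σ)
    (IsLast X v) (fun σ h => (exists_isRightNbr_iff hv σ).1 h)
  have hall : ∀ σ, (∃ x ∈ X, IsRightNbr X v x σ) ∨ IsLast X v σ := fun σ => by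
    rw [exists_isRightNbr_iff hv]; exact (em _).symm
  have hrev : Nat.card {σ // IsLast X v σ} = Nat.card {σ // IsFirst X v σ} :=
    card_mul_left Fin.revPerm _ _ fun σ => isFirst_revPerm_mul.symm
  rw [Nat.card_congr (Equiv.subtypeUnivEquiv hall), Nat.card_perm, Nat.card_fin, key, hrev,
    ← card_isFirst hv] at tot
  have hpos : 0 < #X := card_pos.2 ⟨y, hy⟩
  exact (Nat.eq_of_mul_eq_mul_left hpos (by linarith)).symm

theorem card_isFirst_and_isRightNbr (hv : v ∉ X) {y : Fin n} (hy : y ∈ X) :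
    #X * Nat.card {σ // IsFirst X v σ ∧ IsRightNbr X v y σ} =
      Nat.card {σ // IsFirst X v σ} := by
  rw [← card_filter_exists_mem_eq_mul X (fun x σ => IsFirst X v σ ∧ IsRightNbr X v x σ) _
    (fun σ x _ y _ h h' => h.2.eq h'.2)
    (fun x hx => card_mul_right (Equiv.swap x y) _ _ fun σ => by
      rw [isRightNbr_mul_swap hv hx hy, isFirst_mul_swap hv hx hy, Equiv.swap_apply_right])]
  refine Nat.card_congr (Equiv.subtypeEquivRight fun σ => ?_)
  constructor
  · rintro ⟨x, _, h, _⟩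
    exact h
  · intro h
    obtain ⟨x, hx, hr⟩ := (exists_isRightNbr_iff hv σ).2
      fun hl => lt_asymm (h y hy) (hl y hy)
    exact ⟨x, hx, h, hr⟩

theorem card_isLeftNbr_and_isLast (hv : v ∉ X) {y : Fin n} (hy : y ∈ X) :
    #X * Nat.card {σ // IsLeftNbr X v y σ ∧ IsLast X v σ} =
      Nat.card {σ // IsFirst X v σ} := by
  rw [← card_isFirst_and_isRightNbr hv hy]
  congr 1
  exact card_mul_left Fin.revPerm _ _ fun σ => by
    rw [isFirst_revPerm_mul, isRightNbr_revPerm_mul, and_comm]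

theorem card_isLeftNbr_and_isRightNbr (hv : v ∉ X) {x y : Fin n} (hx : x ∈ X) (hy : y ∈ X)
    (hxy : x ≠ y) :
    #X * Nat.card {σ // IsLeftNbr X v x σ ∧ IsRightNbr X v y σ} =
      Nat.card {σ // IsFirst X v σ} := by
  have key := card_filter_exists_mem_eq_mul (X.erase y)
    (fun z σ => IsLeftNbr X v z σ ∧ IsRightNbr X v y σ)
    (Nat.card {σ // IsLeftNbr X v x σ ∧ IsRightNbr X v y σ})
    (fun σ x _ y _ h h' => h.1.eq h'.1)
    (fun z hz => card_mul_right (Equiv.swap z x) _ _ fun σ => by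
      have hzX := mem_of_mem_erase hz
      rw [isRightNbr_mul_swap hv hzX hx, isLeftNbr_mul_swap hv hzX hx,
        Equiv.swap_apply_right,
        Equiv.swap_apply_of_ne_of_ne (ne_of_mem_erase hz).symm hxy.symm])
  have tot := Nat.card_subtype_or_of_disjoint
    (fun σ => ∃ z ∈ X.erase y, IsLeftNbr X v z σ ∧ IsRightNbr X v y σ)
    (fun σ => IsFirst X v σ ∧ IsRightNbr X v y σ)
    (by
      rintro σ ⟨z, hz, hl, _⟩ ⟨hf, _⟩
      exact lt_asymm hl.2.1 (hf z hl.1))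
  have hall : ∀ σ, ((∃ z ∈ X.erase y, IsLeftNbr X v z σ ∧ IsRightNbr X v y σ) ∨
      (IsFirst X v σ ∧ IsRightNbr X v y σ)) ↔ IsRightNbr X v y σ := by
    intro σ
    constructor
    · rintro (⟨_, _, _, h⟩ | ⟨_, h⟩) <;> exact h
    · intro h
      by_cases hf : IsFirst X v σ
      · exact Or.inr ⟨hf, h⟩
      · obtain ⟨z, hz, hl⟩ := (exists_isLeftNbr_iff hv σ).2 hf
        refine Or.inl ⟨z, mem_erase.2 ⟨?_, hz⟩, hl, h⟩
        rintro rfl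
        exact lt_asymm h.2.1 hl.2.1
  rw [Nat.card_congr (Equiv.subtypeEquivRight hall), key, card_isRightNbr hv hy] at tot
  have hβ := card_isFirst_and_isRightNbr hv hy
  have hpos : 0 < #(X.erase y) := card_pos.2 ⟨x, mem_erase.2 ⟨hxy, hx⟩⟩
  have hc := card_erase_add_one hy
  refine Nat.eq_of_mul_eq_mul_left hpos ?_
  rw [← hc] at hβ ⊢
  generalize #(X.erase y) = e at *
  generalize Nat.card {σ // IsFirst X v σ ∧ IsRightNbr X v y σ} = β at *
  generalize Nat.card {σ // IsFirst X v σ} = m at *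
  generalize Nat.card {σ // IsLeftNbr X v x σ ∧ IsRightNbr X v y σ} = c at *
  subst tot
  nlinarith

/-- The number of words in which every `X`-neighbour of `v` lies in `T`. -/
theorem card_nbrs_mem (hv : v ∉ X) {T : Finset (Fin n)} (hTX : T ⊆ X) (hX : X.Nonempty) :
    #X * (#X + 1) * Nat.card {σ //
      (IsFirst X v σ ∨ ∃ x ∈ T, IsLeftNbr X v x σ) ∧
      (IsLast X v σ ∨ ∃ x ∈ T, IsRightNbr X v x σ)} = #T * (#T + 1) * n ! := by
  set m := Nat.card {σ // IsFirst X v σ} with hm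
  have hpos : 0 < #X := hX.card_pos
  have c1 (y) (hy : y ∈ T) :
      Nat.card {σ // IsFirst X v σ ∧ IsRightNbr X v y σ} = m / #X := by
    rw [hm, ← card_isFirst_and_isRightNbr hv (hTX hy), Nat.mul_div_cancel_left _ hpos]
  have c2 (y) (hy : y ∈ T) :
      Nat.card {σ // IsLeftNbr X v y σ ∧ IsLast X v σ} = m / #X := by
    rw [hm, ← card_isLeftNbr_and_isLast hv (hTX hy), Nat.mul_div_cancel_left _ hpos]
  have c3 (z : Fin n × Fin n) (hz : z ∈ T.offDiag) :
      Nat.card {σ // IsLeftNbr X v z.1 σ ∧ IsRightNbr X v z.2 σ} = m / #X := by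
    rw [mem_offDiag] at hz
    rw [hm, ← card_isLeftNbr_and_isRightNbr hv (hTX hz.1) (hTX hz.2.1) hz.2.2,
      Nat.mul_div_cancel_left _ hpos]
  have k1 := card_filter_exists_mem_eq_mul T
    (fun y σ => IsFirst X v σ ∧ IsRightNbr X v y σ) _
    (fun σ x _ y _ h h' => h.2.eq h'.2) c1
  have k2 := card_filter_exists_mem_eq_mul T
    (fun y σ => IsLeftNbr X v y σ ∧ IsLast X v σ) _
    (fun σ x _ y _ h h' => h.1.eq h'.1) c2
  have k3 := card_filter_exists_mem_eq_mul T.offDiag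
    (fun z σ => IsLeftNbr X v z.1 σ ∧ IsRightNbr X v z.2 σ) _
    (fun σ x _ y _ h h' => Prod.ext (h.1.eq h'.1) (h.2.eq h'.2)) c3
  obtain ⟨u, hu⟩ := hX
  have hfl (σ) (hf : IsFirst X v σ) (hl : IsLast X v σ) : False :=
    lt_asymm (hf u hu) (hl u hu)
  have hfL (σ x) (hf : IsFirst X v σ) (hl : IsLeftNbr X v x σ) : False :=
    lt_asymm (hf x hl.1) hl.2.1
  have hlR (σ x) (hf : IsLast X v σ) (hl : IsRightNbr X v x σ) : False :=
    lt_asymm (hf x hl.1) hl.2.1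
  have d1 := Nat.card_subtype_or_of_disjoint
    (fun σ => ∃ y ∈ T, IsFirst X v σ ∧ IsRightNbr X v y σ)
    (fun σ => ∃ y ∈ T, IsLeftNbr X v y σ ∧ IsLast X v σ)
    (by
      rintro σ ⟨_, _, hf, _⟩ ⟨_, _, _, hl⟩
      exact hfl σ hf hl)
  have d2 := Nat.card_subtype_or_of_disjoint
    (fun σ => (∃ y ∈ T, IsFirst X v σ ∧ IsRightNbr X v y σ) ∨
      ∃ y ∈ T, IsLeftNbr X v y σ ∧ IsLast X v σ)
    (fun σ => ∃ z ∈ T.offDiag, IsLeftNbr X v z.1 σ ∧ IsRightNbr X v z.2 σ)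
    (by
      rintro σ (⟨_, _, hf, _⟩ | ⟨_, _, _, hl⟩) ⟨_, _, hL, hR⟩
      · exact hfL σ _ hf hL
      · exact hlR σ _ hl hR)
  rw [d1, k1, k2, k3] at d2
  have hiff (σ : Equiv.Perm (Fin n)) : ((IsFirst X v σ ∨ ∃ x ∈ T, IsLeftNbr X v x σ) ∧
      (IsLast X v σ ∨ ∃ x ∈ T, IsRightNbr X v x σ)) ↔
      (((∃ y ∈ T, IsFirst X v σ ∧ IsRightNbr X v y σ) ∨
        ∃ y ∈ T, IsLeftNbr X v y σ ∧ IsLast X v σ) ∨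
        ∃ z ∈ T.offDiag, IsLeftNbr X v z.1 σ ∧ IsRightNbr X v z.2 σ) := by
    constructor
    · rintro ⟨hf | ⟨x, hx, hL⟩, hl | ⟨y, hy, hR⟩⟩
      · exact (hfl σ hf hl).elim
      · exact Or.inl (Or.inl ⟨y, hy, hf, hR⟩)
      · exact Or.inl (Or.inr ⟨x, hx, hL, hl⟩)
      · refine Or.inr ⟨(x, y), mem_offDiag.2 ⟨hx, hy, ?_⟩, hL, hR⟩
        rintro (rfl : x = y)
        exact lt_asymm hL.2.1 hR.2.1
    · rintro ((⟨y, hy, hf, hR⟩ | ⟨x, hx, hL, hl⟩) | ⟨z, hz, hL, hR⟩)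
      · exact ⟨Or.inl hf, Or.inr ⟨y, hy, hR⟩⟩
      · exact ⟨Or.inr ⟨x, hx, hL⟩, Or.inl hl⟩
      · rw [mem_offDiag] at hz
        exact ⟨Or.inr ⟨_, hz.1, hL⟩, Or.inr ⟨_, hz.2.1, hR⟩⟩
  have hdvd : #X * (m / #X) = m :=
    Nat.mul_div_cancel' ⟨_, (card_isFirst_and_isRightNbr hv hu).symm⟩
  have hoff : #T.offDiag + #T = #T * #T := by
    rw [offDiag_card]
    exact Nat.sub_add_cancel (Nat.le_mul_self _)
  rw [Nat.card_congr (Equiv.subtypeEquivRight hiff), d2, ← card_isFirst hv, ← hm]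
  calc #X * (#X + 1) * (#T * (m / #X) + #T * (m / #X) + #T.offDiag * (m / #X))
      = (#X + 1) * (#T.offDiag + #T + #T) * (#X * (m / #X)) := by ring
    _ = #T * (#T + 1) * ((#X + 1) * m) := by rw [hdvd, hoff]; ring

end Count

end Neighbours

section Peaks

variable {n k : ℕ} {w : Equiv.Perm (Fin n)} {p : Fin n}

/-- To the left of `p`, an entry at most `w p - k` occurs before (going leftwards) any
entry exceeding `w p`. -/
def LeftProminent (k : ℕ) {n : ℕ} (w : Equiv.Perm (Fin n)) (p : Fin n) : Prop :=
  ∀ i < p, w p < w i → ∃ l, i < l ∧ l < p ∧ (w l : ℕ) + k ≤ w p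

/-- To the right of `p`, an entry at most `w p - k` occurs before any entry exceeding
`w p`. -/
def RightProminent (k : ℕ) {n : ℕ} (w : Equiv.Perm (Fin n)) (p : Fin n) : Prop :=
  ∀ i, p < i → w p < w i → ∃ l, p < l ∧ l < i ∧ (w l : ℕ) + k ≤ w p

theorem exists_isMaxKDesc_iff (hk : 0 < k) : (∃ q, IsMaxKDesc k w p q) ↔
    LeftProminent k w p ∧ RightProminent k w p ∧ ∃ q, p < q ∧ (w q : ℕ) + k ≤ w p := by
  constructor
  · rintro ⟨q, ⟨hpq, hext, hkq, hno⟩, hmax⟩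
    refine ⟨?_, ?_, q, hpq, hkq⟩
    · by_contra hL
      simp only [LeftProminent, not_forall, not_exists, not_and, not_le] at hL
      have hne : (Finset.univ.filter fun i : Fin n => i < p ∧ w p < w i).Nonempty := by
        obtain ⟨i, hi, hw, -⟩ := hL
        exact ⟨i, by simp [hi, hw]⟩
      obtain ⟨i, hi, hlow⟩ : ∃ i, (i < p ∧ w p < w i) ∧
          ∀ l, i < l → l < p → w l ≤ w p ∧ (w p : ℕ) < w l + k := by
        obtain ⟨i, hi, him⟩ := Finset.exists_max_image _ id hne
        simp only [Finset.mem_filter, Finset.mem_univ, true_and, id] at hi him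
        refine ⟨i, hi, fun l hil hlp => ⟨?_, ?_⟩⟩
        · by_contra h
          exact absurd (him l ⟨hlp, not_le.1 h⟩) (not_le.2 hil)
        · obtain ⟨i', hi', hw', hl'⟩ := hL
          exact hl' l (lt_of_le_of_lt (him i' ⟨hi', hw'⟩) hil) hlp
      have hdesc : IsKDesc k w i q := by
        have key : ∀ t, i < t → t ≤ q → (w t : ℕ) ≤ w p ∧ (w q : ℕ) ≤ w t := by
          intro t hit htq
          rcases lt_or_ge t p with h | h
          · have := hlow t hit h
            simp only [Fin.le_def] at this
            omega
          · exact hext t h htq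
        have hwi : (w p : ℕ) < w i := hi.2
        refine ⟨hi.1.trans hpq, ?_, by omega, ?_⟩
        · intro t hit htq
          rcases hit.eq_or_lt with rfl | hit
          · omega
          · have := key t hit htq
            omega
        · rintro s t his htq ⟨hst, hup⟩
          have ht := key t (his.trans_lt hst) htq
          rcases his.eq_or_lt with rfl | his
          · omega
          · rcases lt_or_ge s p with h | h
            · have := hlow s his h
              omega
            · exact hno s t h htq ⟨hst, hup⟩
      exact hi.1.ne (hmax i q hdesc hi.1.le le_rfl).1
    · intro i hpi hwi
      have hwi' : (w p : ℕ) < w i := hwi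
      refine ⟨q, hpq, ?_, hkq⟩
      by_contra h
      have := hext i hpi.le (not_lt.1 h)
      omega
  · rintro ⟨hL, hR, hex⟩
    have hfin : ∀ S : Finset (Fin n), S.Nonempty → ∃ x ∈ S, ∀ y ∈ S, x ≤ y := fun S hS =>
      S.exists_min_image id hS
    -- the first low entry to the right of `p`
    obtain ⟨q₀, ⟨hpq₀, hq₀⟩, hfirst⟩ : ∃ q, (p < q ∧ (w q : ℕ) + k ≤ w p) ∧
        ∀ t, p < t → (w t : ℕ) + k ≤ w p → q ≤ t := by
      obtain ⟨q, hq, hm⟩ := hfin (Finset.univ.filter fun q => p < q ∧ (w q : ℕ) + k ≤ w p)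
        (by obtain ⟨q, hq⟩ := hex; exact ⟨q, by simpa using hq⟩)
      simp only [Finset.mem_filter, Finset.mem_univ, true_and, and_imp] at hq hm
      exact ⟨q, hq, hm⟩
    have hbase : IsKDesc k w p q₀ := by
      have key : ∀ t, p ≤ t → t < q₀ → (w t : ℕ) ≤ w p ∧ (w p : ℕ) < w t + k := by
        intro t hpt htq
        rcases hpt.eq_or_lt with rfl | hpt
        · omega
        · constructor
          · by_contra h
            obtain ⟨l, hl, hlt, hlow⟩ := hR t hpt (Fin.lt_def.2 (by omega))
            exact absurd (hfirst l hl hlow) (not_le.2 (hlt.trans htq))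
          · by_contra h
            exact absurd (hfirst t hpt (by omega)) (not_le.2 htq)
      have hle : ∀ t, p ≤ t → t ≤ q₀ → (w t : ℕ) ≤ w p ∧ (w q₀ : ℕ) ≤ w t := by
        intro t hpt htq
        rcases htq.eq_or_lt with rfl | htq
        · omega
        · have := key t hpt htq
          omega
      refine ⟨hpq₀, hle, hq₀, ?_⟩
      rintro s t hps htq ⟨hst, hup⟩
      have h1 := key s hps (hst.trans_le htq)
      have h2 := hle t (hps.trans hst.le) htq
      omega
    classical
    obtain ⟨q, hq, hqmax⟩ := Finset.exists_max_image
      (Finset.univ.filter fun q => IsKDesc k w p q) id ⟨q₀, by simpa using hbase⟩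
    simp only [Finset.mem_filter, Finset.mem_univ, true_and, id] at hq hqmax
    refine ⟨q, hq, fun i' j' hd hi hj => ?_⟩
    obtain rfl : i' = p := by
      by_contra hne
      have hlt := lt_of_le_of_ne hi hne
      have hpj : p ≤ j' := hq.1.le.trans hj
      have hw1 := (hd.2.1 p hi hpj).1
      have hw2 : (w i' : ℕ) ≠ w p := fun h => hne (w.injective (Fin.ext h))
      obtain ⟨l, hl, hlp, hlow⟩ := hL i' hlt (Fin.lt_def.2 (by omega))
      exact hd.2.2.2 l p hl.le hpj ⟨hlp, hlow⟩
    exact ⟨rfl, le_antisymm (hqmax j' hd) hj⟩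

theorem isKDesc_mul_revPerm {i j : Fin n} :
    IsKDesc k (w * Fin.revPerm) i j ↔ IsKAsc k w j.rev i.rev := by
  have hrev (f : Fin n → Prop) : (∀ t : Fin n, f t) ↔ ∀ t : Fin n, f t.rev :=
    ⟨fun h t => h _, fun h t => by simpa using h t.rev⟩
  unfold IsKAsc IsKDesc IsKDown IsKUp
  simp only [Equiv.Perm.mul_apply, Fin.revPerm_apply, Fin.rev_lt_rev]
  rw [hrev fun t => i ≤ t → _, hrev fun s => ∀ t, i ≤ s → _]
  simp only [Fin.rev_rev]
  refine and_congr Iff.rfl (and_congr ?_ (and_congr Iff.rfl ?_))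
  · refine forall_congr' fun t => ?_
    rw [Fin.le_rev_iff, Fin.rev_le_iff]
    grind
  · rw [forall_comm]
    rw [hrev]
    refine forall_congr' fun t => forall_congr' fun s => ?_
    rw [Fin.le_rev_iff (i := s), Fin.rev_le_iff (i := t)]
    grind [Fin.rev_rev, Fin.lt_rev_iff]

theorem isMaxKDesc_mul_revPerm {i j : Fin n} :
    IsMaxKDesc k (w * Fin.revPerm) i j ↔ IsMaxKAsc k w j.rev i.rev := by
  unfold IsMaxKDesc IsMaxKAsc
  simp only [isKDesc_mul_revPerm]
  refine and_congr Iff.rfl ⟨fun h i' j' hd hi hj => ?_, fun h i' j' hd hi hj => ?_⟩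
  · have := h j'.rev i'.rev (by simpa using hd) (Fin.rev_le_iff.2 hj) (Fin.le_rev_iff.2 hi)
    exact ⟨Fin.rev_eq_iff.1 this.2, Fin.rev_eq_iff.1 this.1⟩
  · have := h j'.rev i'.rev hd (Fin.rev_le_rev.2 hj) (Fin.rev_le_rev.2 hi)
    exact ⟨Fin.rev_injective this.2, Fin.rev_injective this.1⟩

theorem leftProminent_mul_revPerm :
    LeftProminent k (w * Fin.revPerm) p.rev ↔ RightProminent k w p := by
  simp only [LeftProminent, RightProminent, Equiv.Perm.mul_apply, Fin.revPerm_apply,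
    Fin.rev_rev]
  constructor
  · intro h i hi hw
    obtain ⟨l, h1, h2, h3⟩ := h i.rev (Fin.rev_lt_rev.2 hi) (by simpa using hw)
    exact ⟨l.rev, Fin.lt_rev_iff.2 h2, Fin.rev_lt_iff.2 h1, h3⟩
  · intro h i hi hw
    obtain ⟨l, h1, h2, h3⟩ := h i.rev (Fin.lt_rev_iff.2 hi) hw
    exact ⟨l.rev, Fin.lt_rev_iff.2 h2, Fin.rev_lt_rev.2 h1, by simpa using h3⟩

theorem rightProminent_mul_revPerm :
    RightProminent k (w * Fin.revPerm) p.rev ↔ LeftProminent k w p := by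
  have h := leftProminent_mul_revPerm (k := k) (w := w * Fin.revPerm) (p := p.rev)
  have hw : w * Fin.revPerm * Fin.revPerm = w := by ext; simp
  rw [hw, Fin.rev_rev] at h
  exact h.symm

theorem exists_isMaxKAsc_iff (hk : 0 < k) : (∃ q, IsMaxKAsc k w q p) ↔
    LeftProminent k w p ∧ RightProminent k w p ∧ ∃ q, q < p ∧ (w q : ℕ) + k ≤ w p := by
  have h := exists_isMaxKDesc_iff (w := w * Fin.revPerm) (p := p.rev) hk
  have hrev (f : Fin n → Prop) : (∃ t : Fin n, f t) ↔ ∃ t : Fin n, f t.rev :=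
    Fin.revPerm.exists_congr_right.symm
  rw [leftProminent_mul_revPerm, rightProminent_mul_revPerm, hrev,
    hrev fun q => p.rev < q ∧ _] at h
  simp only [isMaxKDesc_mul_revPerm, Equiv.Perm.mul_apply, Fin.revPerm_apply, Fin.rev_rev,
    Fin.rev_lt_rev] at h
  rw [h, _root_.and_left_comm]

theorem isKPeakPos_iff_s18 (hk : 0 < k) (hp : k ≤ w p) :
    IsKPeakPos k w p ↔ LeftProminent k w p ∧ RightProminent k w p := by
  rw [IsKPeakPos, exists_isMaxKDesc_iff hk, exists_isMaxKAsc_iff hk]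
  constructor
  · rintro (⟨hl, hr, _⟩ | ⟨hl, hr, _⟩) <;> exact ⟨hl, hr⟩
  · rintro ⟨hl, hr⟩
    have hn : 0 < n := p.pos
    let q : Fin n := w.symm ⟨0, hn⟩
    have hq : (w q : ℕ) = 0 := by simp [q]
    have hne : q ≠ p := by
      rintro h
      rw [h] at hq
      omega
    rcases lt_or_gt_of_ne hne with h | h
    · exact Or.inl ⟨hl, hr, q, h, by omega⟩
    · exact Or.inr ⟨hl, hr, q, h, by omega⟩

theorem leftProminent_symm_iff {σ : Equiv.Perm (Fin n)} {v : Fin n} {T X : Finset (Fin n)}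
    (hT : ∀ x, x ∈ T ↔ (x : ℕ) + k ≤ v) (hX : ∀ x, x ∈ X ↔ x ∈ T ∨ v < x) (hv : v ∉ X) :
    LeftProminent k σ⁻¹ (σ v) ↔ IsFirst X v σ ∨ ∃ x ∈ T, IsLeftNbr X v x σ := by
  have hdef : LeftProminent k σ⁻¹ (σ v) ↔
      ∀ a, v < a → σ a < σ v → ∃ l ∈ T, σ a < σ l ∧ σ l < σ v := by
    unfold LeftProminent
    rw [← σ.forall_congr_right]
    simp only [perm_inv_apply_apply, hT]
    refine forall_congr' fun a => ⟨fun h h1 h2 => ?_, fun h h1 h2 => ?_⟩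
    · obtain ⟨l, h3, h4, h5⟩ := h h2 h1
      exact ⟨σ⁻¹ l, h5, by simpa using h3, by simpa using h4⟩
    · obtain ⟨l, h5, h3, h4⟩ := h h2 h1
      exact ⟨σ l, h3, h4, by simpa using h5⟩
  rw [hdef]
  constructor
  · intro h
    rw [or_iff_not_imp_left, ← exists_isLeftNbr_iff hv]
    rintro ⟨x, hx, hL⟩
    refine ⟨x, ((hX x).1 hx).resolve_right fun hvx => ?_, hL⟩
    obtain ⟨l, hl, h1, h2⟩ := h x hvx hL.2.1
    exact absurd (hL.2.2 l ((hX l).2 (Or.inl hl)) h2) (not_le.2 h1)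
  · rintro (h | ⟨x, hx, hL⟩) a hva ha
    · exact absurd (h a ((hX a).2 (Or.inr hva))) (lt_asymm ha)
    · refine ⟨x, hx, lt_of_le_of_ne (hL.2.2 a ((hX a).2 (Or.inr hva)) ha) fun he => ?_, hL.2.1⟩
      have := (hT x).1 hx
      have hva' : (v : ℕ) < a := hva
      rw [σ.injective he] at hva'
      omega

theorem rightProminent_symm_iff {σ : Equiv.Perm (Fin n)} {v : Fin n} {T X : Finset (Fin n)}
    (hT : ∀ x, x ∈ T ↔ (x : ℕ) + k ≤ v) (hX : ∀ x, x ∈ X ↔ x ∈ T ∨ v < x) (hv : v ∉ X) :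
    RightProminent k σ⁻¹ (σ v) ↔ IsLast X v σ ∨ ∃ x ∈ T, IsRightNbr X v x σ := by
  have h := leftProminent_symm_iff (σ := Fin.revPerm * σ) hT hX hv
  have hinv : (Fin.revPerm * σ)⁻¹ = σ⁻¹ * Fin.revPerm := by
    rw [mul_inv_rev]; rfl
  rw [hinv, Equiv.Perm.mul_apply, Fin.revPerm_apply, leftProminent_mul_revPerm] at h
  simpa only [isFirst_revPerm_mul, isLeftNbr_revPerm_mul] using h

end Peaks

/-- For `k < j ≤ n`, the number of permutations in `S_n` in which the value `j` is a
`k`-peak equals `n! · (j-k)(j-k+1) / ((n-k)(n-k+1))`. -/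
theorem card_value_j_is_kPeak (n k j : ℕ) (hk : 2 ≤ k + 1) (hkn : k + 1 ≤ n)
    (hjk : k < j) (hjn : j ≤ n) :
    (n - k) * (n - k + 1) *
        Nat.card {w : Equiv.Perm (Fin n) //
          ∃ p : Fin n, (w p : ℕ) + 1 = j ∧ IsKPeakPos k w p} =
      (j - k) * (j - k + 1) * n ! := by
  have hk0 : 0 < k := by omega
  let v : Fin n := ⟨j - 1, by omega⟩
  have hvj : (v : ℕ) + 1 = j := by simp only [v]; omega
  let T : Finset (Fin n) := Finset.univ.filter fun x => (x : ℕ) + k ≤ v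
  let X : Finset (Fin n) := T ∪ Finset.Ioi v
  have hT (x : Fin n) : x ∈ T ↔ (x : ℕ) + k ≤ v := by simp [T]
  have hX (x : Fin n) : x ∈ X ↔ x ∈ T ∨ v < x := by simp [X]
  have hv : v ∉ X := by
    rw [hX, hT]
    simp [hk0.ne']
  have hTcard : T.card = j - k := by
    have : T = Finset.Iic ⟨v - k, by omega⟩ := by
      ext x
      rw [hT, Finset.mem_Iic, Fin.le_def]
      simp only
      omega
    rw [this, Fin.card_Iic]
    simp only
    omega
  have hXcard : X.card = n - k := by
    rw [Finset.card_union_of_disjoint, hTcard, Fin.card_Ioi]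
    · omega
    · rw [Finset.disjoint_left]
      intro x hx hx'
      rw [hT] at hx
      rw [Finset.mem_Ioi, Fin.lt_def] at hx'
      omega
  have hXne : X.Nonempty := by
    rw [← Finset.card_pos]
    omega
  have hiff (σ : Equiv.Perm (Fin n)) :
      (∃ p : Fin n, (σ⁻¹ p : ℕ) + 1 = j ∧ IsKPeakPos k σ⁻¹ p) ↔
        (IsFirst X v σ ∨ ∃ x ∈ T, IsLeftNbr X v x σ) ∧
        (IsLast X v σ ∨ ∃ x ∈ T, IsRightNbr X v x σ) := by
    rw [← leftProminent_symm_iff hT hX hv, ← rightProminent_symm_iff hT hX hv,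
      ← isKPeakPos_iff_s18 hk0 (by rw [perm_inv_apply_apply]; omega)]
    constructor
    · rintro ⟨p, hp, hpeak⟩
      obtain rfl : p = σ v := by
        rw [← Equiv.Perm.inv_eq_iff_eq]
        exact Fin.ext (by omega)
      exact hpeak
    · intro h
      exact ⟨σ v, by rw [perm_inv_apply_apply]; exact hvj, h⟩
  have key := card_nbrs_mem hv (T := T) Finset.subset_union_left hXne
  rw [hXcard, hTcard] at key
  rw [← key, ← Nat.card_congr (Equiv.subtypeEquivRight hiff)]
  congr 1
  exact Nat.card_congr ((Equiv.inv _).subtypeEquiv fun w => by simp)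
end
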